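/- arXiv:2310.17449 — 3 statements merged into one kernel-verified Lean document; each statement's English description precedes it below -/
import Mathlib

section
/- Fix ε, r ∈ (0,1). Let f₁ : ℂ → ℂ be entire, let A ∈ ℂ with A ≠ 0, and let F(ζ) = A/(1−ζ) + f₁(ζ)·log(1−ζ)/(2πi), which is holomorphic on the unit disk {|ζ| < 1}; denote by (a_n)_{n≥0} its Taylor coefficients at 0. Let U = {ζ ∈ ℂ : |ζ| < 1+ε} ∖ [1, 1+ε) and let g : U → ℂ be holomorphic, with Taylor coefficients (b_n)_{n≥0} at 0. Assume there exist B ∈ ℂ and functions g₁, g₂ holomorphic on the disk D(1,r) such that g(ζ) = B/(1−ζ) + g₁(ζ)·log(1−ζ)/(2πi) + g₂(ζ) for all ζ ∈ D(1,r) with ζ ∉ [1,∞), and assume that B ≠ 0 or g₁ is not identically zero on D(1,r). Then the Hadamard product h(ζ) = Σ_{n≥0} a_n b_n ζ^n, which converges for |ζ| < 1, is singular at 1: there exist no δ > 0 and holomorphic function H on D(1,δ) such that H(ζ) = h(ζ) for all real ζ ∈ (1−δ, 1). -/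
open Metric Complex
open Filter Topology MeasureTheory

/-- The sum of the power series with coefficients `b`. -/
noncomputable def powSum (b : ℕ → ℂ) (z : ℂ) : ℂ := ∑' n, b n * z ^ n

/-- The power series with coefficients `b` converges on the unit disk. -/
def ConvergesOnUnitDisk (b : ℕ → ℂ) : Prop :=
  ∀ z : ℂ, ‖z‖ < 1 → Summable fun n => b n * z ^ n

/-- The power series with coefficients `d` agrees, to the left of `1` on the real axis, with a
function holomorphic near `1`. -/
def ContinuesAtOne (d : ℕ → ℂ) : Prop :=
  ∃ H : ℂ → ℂ, AnalyticAt ℂ H 1 ∧ ∀ᶠ t : ℝ in 𝓝[<] 1, powSum d t = H t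

namespace ConvergesOnUnitDisk

variable {a b : ℕ → ℂ}

theorem summable_norm_mul_pow (hb : ConvergesOnUnitDisk b) {ρ : ℝ} (h0 : 0 ≤ ρ) (h1 : ρ < 1) :
    Summable fun n => ‖b n‖ * ρ ^ n := by
  have h := (hb (ρ : ℂ) (by simpa [abs_of_nonneg h0] using h1)).norm
  simpa [abs_of_nonneg h0] using h

theorem hadamard (ha : ConvergesOnUnitDisk a) (hb : ConvergesOnUnitDisk b) :
    ConvergesOnUnitDisk fun n => a n * b n := by
  intro z hz
  have hρ1 : √‖z‖ < 1 := by rw [Real.sqrt_lt' one_pos]; simpa using hz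
  have sa := ha.summable_norm_mul_pow (Real.sqrt_nonneg _) hρ1
  have sb := hb.summable_norm_mul_pow (Real.sqrt_nonneg _) hρ1
  obtain ⟨M, hM⟩ := sa.tendsto_atTop_zero.bddAbove_range
  refine Summable.of_norm_bounded (sb.mul_left M) fun n => ?_
  have hz' : ‖z‖ ^ n = √‖z‖ ^ n * √‖z‖ ^ n := by
    rw [← mul_pow, Real.mul_self_sqrt (norm_nonneg z)]
  calc ‖a n * b n * z ^ n‖ = (‖a n‖ * √‖z‖ ^ n) * (‖b n‖ * √‖z‖ ^ n) := by
        rw [norm_mul, norm_mul, norm_pow, hz']; ring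
    _ ≤ M * (‖b n‖ * √‖z‖ ^ n) := by
        gcongr
        exact hM ⟨n, rfl⟩

theorem hasDerivAt_powSum (hb : ConvergesOnUnitDisk b) {z : ℂ} (hz : ‖z‖ < 1) :
    HasDerivAt (powSum b) (deriv (powSum b) z) z ∧
      HasSum (fun n => n * b n * z ^ n) (z * deriv (powSum b) z) := by
  obtain ⟨ρ, hzρ, hρ1⟩ := exists_between hz
  have h0 : 0 ≤ ρ := (norm_nonneg z).trans hzρ.le
  have hu := hb.summable_norm_mul_pow h0 hρ1
  have hd : ∀ n, DifferentiableOn ℂ (fun w => b n * w ^ n) (ball (0 : ℂ) ρ) :=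
    fun n => by fun_prop
  have hle : ∀ n, ∀ w ∈ ball (0 : ℂ) ρ, ‖b n * w ^ n‖ ≤ ‖b n‖ * ρ ^ n := by
    intro n w hw
    rw [norm_mul, norm_pow]
    have : ‖w‖ ≤ ρ := by simpa using (mem_ball_zero_iff.1 hw).le
    gcongr
  have hmem : z ∈ ball (0 : ℂ) ρ := by simpa using hzρ
  refine ⟨((differentiableOn_tsum_of_summable_norm hu hd isOpen_ball hle).differentiableAt
    (isOpen_ball.mem_nhds hmem)).hasDerivAt, ?_⟩
  refine ((hasSum_deriv_of_summable_norm hu hd isOpen_ball hle hmem).mul_left z).congr_fun ?_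
  intro n
  rcases n with _ | n
  · simp
  · simp only [deriv_const_mul_field, deriv_pow_field, Nat.add_sub_cancel]
    push_cast
    ring

theorem continuousAt_powSum (hb : ConvergesOnUnitDisk b) {z : ℂ} (hz : ‖z‖ < 1) :
    ContinuousAt (powSum b) z :=
  (hb.hasDerivAt_powSum hz).1.continuousAt

theorem nat_mul (hb : ConvergesOnUnitDisk b) : ConvergesOnUnitDisk fun n => n * b n :=
  fun _ hz => (hb.hasDerivAt_powSum hz).2.summable

theorem powSum_nat_mul (hb : ConvergesOnUnitDisk b) {z : ℂ} (hz : ‖z‖ < 1) :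
    powSum (fun n => n * b n) z = z * deriv (powSum b) z :=
  (hb.hasDerivAt_powSum hz).2.tsum_eq

/-- A formula for a power series along the real segment ending at `1` can be differentiated. -/
theorem powSum_nat_mul_of_eventuallyEq (hb : ConvergesOnUnitDisk b) {f f' : ℝ → ℂ}
    (hf : ∀ᶠ t : ℝ in 𝓝[<] 1, powSum b t = f t)
    (hf' : ∀ᶠ t : ℝ in 𝓝[<] 1, HasDerivAt f (f' t) t) :
    ∀ᶠ t : ℝ in 𝓝[<] 1, powSum (fun n => n * b n) t = t * f' t := by
  have hpos : ∀ᶠ t : ℝ in 𝓝[<] 1, 0 < t :=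
    (lt_mem_nhds one_pos).filter_mono nhdsWithin_le_nhds
  filter_upwards [eventually_eventually_nhdsWithin.2 hf, hf', self_mem_nhdsWithin, hpos]
    with t ht ht' ht1 ht0
  have hn : ‖(t : ℂ)‖ < 1 := by simpa [abs_of_pos ht0] using ht1
  rw [isOpen_Iio.nhdsWithin_eq ht1] at ht
  rw [hb.powSum_nat_mul hn,
    ((hb.hasDerivAt_powSum hn).1.comp_ofReal.congr_of_eventuallyEq
      (ht.mono fun _ h => h.symm)).unique ht']

end ConvergesOnUnitDisk


theorem tendsto_ofReal_nhdsLT_one : Tendsto (fun t : ℝ => (t : ℂ)) (𝓝[<] 1) (𝓝 1) :=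
  tendsto_nhdsWithin_of_tendsto_nhds (by simpa using continuous_ofReal.tendsto (1 : ℝ))

theorem tendsto_one_sub_nhdsLT_one :
    Tendsto (fun t : ℝ => 1 - (t : ℂ)) (𝓝[<] 1) (𝓝 0) := by
  simpa using tendsto_ofReal_nhdsLT_one.const_sub 1

theorem tendsto_one_sub_mul_log :
    Tendsto (fun t : ℝ => (1 - (t : ℂ)) * (Real.log (1 - t) : ℂ)) (𝓝[<] 1) (𝓝 0) := by
  have h : Tendsto (fun t : ℝ => 1 - t) (𝓝[<] 1) (𝓝[>] 0) := by
    refine tendsto_nhdsWithin_iff.2 ⟨?_, ?_⟩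
    · exact tendsto_nhdsWithin_of_tendsto_nhds
        (by simpa using (by fun_prop : Continuous fun t : ℝ => 1 - t).tendsto 1)
    · filter_upwards [self_mem_nhdsWithin] with t ht
      simpa using ht
  have hlog : Tendsto (fun x => Real.log x * x) (𝓝[>] 0) (𝓝 0) := by
    simpa only [Real.rpow_one] using tendsto_log_mul_rpow_nhdsGT_zero zero_lt_one
  have h2 := (continuous_ofReal.tendsto _).comp (hlog.comp h)
  simp only [ofReal_zero] at h2
  refine h2.congr fun t => ?_
  simp [mul_comm]

namespace ContinuesAtOne

variable {d : ℕ → ℂ}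

theorem tendsto_one_sub_mul (h : ContinuesAtOne d) :
    Tendsto (fun t : ℝ => (1 - (t : ℂ)) * powSum d t) (𝓝[<] 1) (𝓝 0) := by
  obtain ⟨H, hH, he⟩ := h
  have := tendsto_one_sub_nhdsLT_one.mul (hH.continuousAt.tendsto.comp tendsto_ofReal_nhdsLT_one)
  rw [zero_mul] at this
  refine this.congr' ?_
  filter_upwards [he] with t ht
  simp [ht]

theorem nat_mul (h : ContinuesAtOne d) (hd : ConvergesOnUnitDisk d) :
    ContinuesAtOne fun n => n * d n := by
  obtain ⟨H, hH, he⟩ := h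
  refine ⟨fun z => z * deriv H z, analyticAt_id.mul hH.deriv,
    hd.powSum_nat_mul_of_eventuallyEq he ?_⟩
  filter_upwards [tendsto_ofReal_nhdsLT_one.eventually hH.eventually_analyticAt] with t ht
  exact ht.differentiableAt.hasDerivAt.comp_ofReal

end ContinuesAtOne

theorem exists_bound_one_sub_mul_powSum {b : ℕ → ℂ} (hb : ConvergesOnUnitDisk b) {c : ℂ}
    (hc : Tendsto (fun t : ℝ => (1 - (t : ℂ)) * powSum b t) (𝓝[<] 1) (𝓝 c)) :
    ∃ K, ∀ t : ℝ, 0 ≤ t → t < 1 → ‖(1 - (t : ℂ)) * powSum b t‖ ≤ K := by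
  have h1 : ∀ᶠ t : ℝ in 𝓝[<] 1, ‖(1 - (t : ℂ)) * powSum b t‖ < ‖c‖ + 1 :=
    hc.norm.eventually (gt_mem_nhds (by linarith))
  obtain ⟨s, hs, hs'⟩ := (mem_nhdsLT_iff_exists_Ioo_subset).1 h1
  have hcont : ContinuousOn (fun t : ℝ => (1 - (t : ℂ)) * powSum b t) (Set.Icc 0 s) := by
    intro t ht
    have hn : ‖(t : ℂ)‖ < 1 := by
      simpa [abs_of_nonneg ht.1] using ht.2.trans_lt hs
    have := (hb.continuousAt_powSum hn).comp (f := fun t : ℝ => (t : ℂ))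
      continuous_ofReal.continuousAt
    exact ((by fun_prop : ContinuousAt (fun t : ℝ => 1 - (t : ℂ)) t).mul this).continuousWithinAt
  obtain ⟨K, hK⟩ := isCompact_Icc.exists_bound_of_continuousOn hcont
  refine ⟨max K (‖c‖ + 1), fun t h0 h1 => ?_⟩
  rcases le_or_gt t s with hts | hts
  · exact (hK t ⟨h0, hts⟩).trans (le_max_left _ _)
  · exact (hs' ⟨hts, h1⟩ : _ < _).le.trans (le_max_right _ _)

theorem tendsto_one_sub_mul_integral {b : ℕ → ℂ} (hb : ConvergesOnUnitDisk b) {c : ℂ}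
    (hc : Tendsto (fun t : ℝ => (1 - (t : ℂ)) * powSum b t) (𝓝[<] 1) (𝓝 c))
    {ψ : ℝ → ℂ} (hψ : ContinuousOn ψ (Set.Icc (1 / 2) 1)) :
    Tendsto (fun t : ℝ => (1 - (t : ℂ)) * ∫ u in (1 / 2 : ℝ)..1, ψ u * powSum b (t * u))
      (𝓝[<] 1) (𝓝 0) := by
  obtain ⟨K, hK⟩ := exists_bound_one_sub_mul_powSum hb hc
  have hψ' : ContinuousOn ψ (Set.uIcc (1 / 2) 1) := by
    rwa [Set.uIcc_of_le (by norm_num)]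
  have hI : Set.uIoc (1 / 2 : ℝ) 1 = Set.Ioc (1 / 2) 1 := Set.uIoc_of_le (by norm_num)
  have hlt : ∀ᶠ t : ℝ in 𝓝[<] 1, 0 ≤ t ∧ t < 1 := by
    filter_upwards [self_mem_nhdsWithin,
      (lt_mem_nhds one_pos).filter_mono nhdsWithin_le_nhds] with t h1 h2 using ⟨h2.le, h1⟩
  simp_rw [← intervalIntegral.integral_const_mul]
  have h0 : (0 : ℂ) = ∫ u in (1 / 2 : ℝ)..1, (0 : ℂ) := by simp
  rw [h0]
  refine intervalIntegral.tendsto_integral_filter_of_dominated_convergence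
    (fun u => K * ‖ψ u‖) ?_ ?_ ?_ ?_
  · filter_upwards [hlt] with t ht
    refine ContinuousOn.aestronglyMeasurable ?_ measurableSet_uIoc
    refine continuousOn_const.mul ((hψ'.mono Set.uIoc_subset_uIcc).mul ?_)
    intro u hu
    rw [hI] at hu
    have hu0 : 0 ≤ u := by linarith [hu.1]
    have hn : ‖(t : ℂ) * u‖ < 1 := by
      simpa [abs_of_nonneg ht.1, abs_of_nonneg hu0] using
        (mul_le_of_le_one_right ht.1 hu.2).trans_lt ht.2
    exact ((hb.continuousAt_powSum hn).comp (f := fun u : ℝ => (t : ℂ) * u)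
      (by fun_prop)).continuousWithinAt
  · filter_upwards [hlt] with t ht
    refine Eventually.of_forall fun u hu => ?_
    rw [hI] at hu
    have hu0 : 0 ≤ u := by linarith [hu.1]
    have htu : t * u ≤ t := mul_le_of_le_one_right ht.1 hu.2
    have hb' := hK (t * u) (mul_nonneg ht.1 hu0) (htu.trans_lt ht.2)
    have hle : ‖(1 - (t : ℂ))‖ ≤ ‖(1 - ((t * u : ℝ) : ℂ))‖ := by
      rw [← ofReal_one, ← ofReal_sub, ← ofReal_sub, norm_real, norm_real, Real.norm_eq_abs,
        Real.norm_eq_abs, abs_of_nonneg (by linarith [ht.2]), abs_of_nonneg (by linarith [ht.2])]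
      linarith
    calc ‖(1 - (t : ℂ)) * (ψ u * powSum b (t * u))‖
        = ‖(1 - (t : ℂ))‖ * ‖powSum b ((t * u : ℝ) : ℂ)‖ * ‖ψ u‖ := by
          rw [norm_mul, norm_mul, ofReal_mul]; ring
      _ ≤ ‖(1 - ((t * u : ℝ) : ℂ))‖ * ‖powSum b ((t * u : ℝ) : ℂ)‖ * ‖ψ u‖ := by gcongr
      _ ≤ K * ‖ψ u‖ := by
          rw [← norm_mul]
          gcongr
  · exact (continuousOn_const.mul hψ'.norm).intervalIntegrable
  · have hne : ∀ᵐ u : ℝ, u ≠ 1 := by simp [ae_iff, measure_singleton]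
    filter_upwards [hne] with u hu1 hu
    rw [hI] at hu
    have hu0 : 0 ≤ u := by linarith [hu.1]
    have hn : ‖(u : ℂ)‖ < 1 := by
      simpa [abs_of_nonneg hu0] using lt_of_le_of_ne hu.2 hu1
    have h2 : Tendsto (fun t : ℝ => (t : ℂ) * u) (𝓝[<] 1) (𝓝 (u : ℂ)) := by
      simpa using tendsto_ofReal_nhdsLT_one.mul_const (u : ℂ)
    simpa using tendsto_one_sub_nhdsLT_one.mul
      (((hb.continuousAt_powSum hn).tendsto.comp h2).const_mul (ψ u))

theorem hasSum_integral_mul_pow {b : ℕ → ℂ} (hb : ConvergesOnUnitDisk b)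
    {ψ : ℝ → ℂ} (hψ : ContinuousOn ψ (Set.Icc (1 / 2) 1)) {t : ℝ} (h0 : 0 ≤ t) (h1 : t < 1) :
    HasSum (fun n => (∫ u in (1 / 2 : ℝ)..1, ψ u * (u : ℂ) ^ n) * b n * (t : ℂ) ^ n)
      (∫ u in (1 / 2 : ℝ)..1, ψ u * powSum b (t * u)) := by
  obtain ⟨M, hM⟩ := isCompact_Icc.exists_bound_of_continuousOn hψ
  have hψ' : ContinuousOn ψ (Set.uIcc (1 / 2) 1) := by
    rwa [Set.uIcc_of_le (by norm_num)]
  have hI : Set.uIoc (1 / 2 : ℝ) 1 = Set.Ioc (1 / 2) 1 := Set.uIoc_of_le (by norm_num)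
  have hs := (hb.summable_norm_mul_pow h0 h1).mul_left M
  have key : HasSum (fun n => ∫ u in (1 / 2 : ℝ)..1, ψ u * (b n * (t * u : ℂ) ^ n))
      (∫ u in (1 / 2 : ℝ)..1, ψ u * powSum b (t * u)) := by
    refine intervalIntegral.hasSum_integral_of_dominated_convergence
      (fun n _ => M * (‖b n‖ * t ^ n)) ?_ ?_ ?_ ?_ ?_
    · intro n
      refine ContinuousOn.aestronglyMeasurable ?_ measurableSet_uIoc
      exact (hψ'.mono Set.uIoc_subset_uIcc).mul (by fun_prop)
    · intro n
      refine Eventually.of_forall fun u hu => ?_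
      rw [hI] at hu
      have hu0 : 0 ≤ u := by linarith [hu.1]
      have hM' := hM u ⟨hu.1.le, hu.2⟩
      rw [norm_mul, norm_mul, norm_pow, norm_mul, norm_real, norm_real, Real.norm_of_nonneg h0,
        Real.norm_of_nonneg hu0]
      have := mul_le_of_le_one_right h0 hu.2
      have hM0 : 0 ≤ M := (norm_nonneg _).trans hM'
      gcongr
    · exact Eventually.of_forall fun _ _ => hs
    · exact intervalIntegrable_const
    · refine Eventually.of_forall fun u hu => ?_
      rw [hI] at hu
      have hu0 : 0 ≤ u := by linarith [hu.1]
      have hn : ‖(t : ℂ) * u‖ < 1 := by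
        simpa [abs_of_nonneg h0, abs_of_nonneg hu0] using
          (mul_le_of_le_one_right h0 hu.2).trans_lt h1
      exact (hb _ hn).hasSum.mul_left (ψ u)
  refine key.congr_fun fun n => ?_
  rw [mul_assoc, ← intervalIntegral.integral_mul_const]
  congr 1
  ext u
  ring

/-- Termwise multiplication by `A + ∫ ψ(u) uⁿ du + O(2⁻ⁿ)` multiplies the coefficient of the
leading singularity `1 / (1 - t)` by `A`. -/
theorem tendsto_one_sub_mul_powSum_hadamard {a b : ℕ → ℂ} (hb : ConvergesOnUnitDisk b) {c : ℂ}
    (hc : Tendsto (fun t : ℝ => (1 - (t : ℂ)) * powSum b t) (𝓝[<] 1) (𝓝 c))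
    {A : ℂ} {ψ : ℝ → ℂ} (hψ : ContinuousOn ψ (Set.Icc (1 / 2) 1)) {M : ℝ}
    (ha : ∀ n, ‖a n - A - ∫ u in (1 / 2 : ℝ)..1, ψ u * (u : ℂ) ^ n‖ ≤ M * (1 / 2) ^ n) :
    Tendsto (fun t : ℝ => (1 - (t : ℂ)) * powSum (fun n => a n * b n) t) (𝓝[<] 1)
      (𝓝 (A * c)) := by
  set e : ℕ → ℂ := fun n => a n - A - ∫ u in (1 / 2 : ℝ)..1, ψ u * (u : ℂ) ^ n with he
  have hs := (hb.summable_norm_mul_pow (ρ := 1 / 2) (by norm_num) (by norm_num)).mul_left M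
  have hle : ∀ t : ℝ, 0 ≤ t → t < 1 → ∀ n,
      ‖e n * b n * (t : ℂ) ^ n‖ ≤ M * (‖b n‖ * (1 / 2) ^ n) := by
    intro t h0 h1 n
    have ht : ‖(t : ℂ) ^ n‖ ≤ 1 := by
      rw [norm_pow, norm_real, Real.norm_of_nonneg h0]
      exact pow_le_one₀ h0 h1.le
    calc ‖e n * b n * (t : ℂ) ^ n‖ = ‖e n‖ * ‖b n‖ * ‖(t : ℂ) ^ n‖ := by
          rw [norm_mul, norm_mul]
      _ ≤ (M * (1 / 2) ^ n) * ‖b n‖ * 1 := by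
          have := ha n
          gcongr
          exact mul_nonneg ((norm_nonneg _).trans this) (norm_nonneg _)
      _ = _ := by ring
  have hlt : ∀ᶠ t : ℝ in 𝓝[<] 1, 0 ≤ t ∧ t < 1 := by
    filter_upwards [self_mem_nhdsWithin,
      (lt_mem_nhds one_pos).filter_mono nhdsWithin_le_nhds] with t h1 h2 using ⟨h2.le, h1⟩
  have h3 : Tendsto (fun t : ℝ => (1 - (t : ℂ)) * powSum (fun n => e n * b n) t)
      (𝓝[<] 1) (𝓝 0) := by
    refine tendsto_one_sub_nhdsLT_one.zero_mul_isBoundedUnder_le ?_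
    refine isBoundedUnder_of_eventually_le (a := ∑' n, M * (‖b n‖ * (1 / 2) ^ n)) ?_
    filter_upwards [hlt] with t ht
    exact tsum_of_norm_bounded hs.hasSum (hle t ht.1 ht.2)
  have h := ((hc.const_mul A).add (tendsto_one_sub_mul_integral hb hc hψ)).add h3
  simp only [add_zero] at h
  refine h.congr' ?_
  filter_upwards [hlt] with t ht
  have hn : ‖(t : ℂ)‖ < 1 := by simpa [abs_of_nonneg ht.1] using ht.2
  have hsum := (((hb _ hn).hasSum.mul_left A).add
    (hasSum_integral_mul_pow hb hψ ht.1 ht.2)).add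
    (Summable.of_norm_bounded hs (hle t ht.1 ht.2)).hasSum
  have : powSum (fun n => a n * b n) t = _ :=
    (hsum.congr_fun (g := fun n => a n * b n * (t : ℂ) ^ n)
      fun n => by simp only [he]; ring).tsum_eq
  rw [this]
  simp only [powSum]
  ring

/-- The coefficients of a power series converging on the unit disk are determined by its sum. -/
theorem eq_of_hasSum_mul_pow {a b : ℕ → ℂ} {f : ℂ → ℂ}
    (ha : ∀ z : ℂ, ‖z‖ < 1 → HasSum (fun n => a n * z ^ n) (f z))
    (hb : ∀ z : ℂ, ‖z‖ < 1 → HasSum (fun n => b n * z ^ n) (f z)) : a = b := by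
  have key : ∀ d : ℕ → ℂ, (∀ z : ℂ, ‖z‖ < 1 → HasSum (fun n => d n * z ^ n) (f z)) →
      HasFPowerSeriesAt f (FormalMultilinearSeries.ofScalars ℂ d) 0 := by
    intro d hd
    rw [hasFPowerSeriesAt_iff]
    filter_upwards [ball_mem_nhds (0 : ℂ) one_pos] with z hz
    simpa [FormalMultilinearSeries.coeff_ofScalars, mul_comm] using hd z (by simpa using hz)
  have h := (key a ha).eq_formalMultilinearSeries (key b hb)
  ext n
  simpa [FormalMultilinearSeries.coeff_ofScalars] using
    congrArg (fun p : FormalMultilinearSeries ℂ ℂ ℂ => p.coeff n) h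

theorem norm_sub_sum_range_le {p : ℕ → ℂ} {f : ℂ → ℂ}
    (hp : ∀ z, HasSum (fun k => p k * z ^ k) (f z)) {v : ℂ} (hv : ‖v‖ ≤ 2) (n : ℕ) :
    ‖f v - ∑ k ∈ Finset.range n, p k * v ^ k‖ ≤ (∑' k, ‖p k‖ * 2 ^ k) * (‖v‖ / 2) ^ n := by
  have hs : Summable fun k => ‖p k‖ * (2 : ℝ) ^ k := by simpa using (hp 2).summable.norm
  have h1 := (hasSum_nat_add_iff' n).2 (hp v)
  have h2 := (((summable_nat_add_iff n).2 hs).mul_right ((‖v‖ / 2) ^ n)).hasSum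
  rw [← h1.tsum_eq]
  refine (tsum_of_norm_bounded h2 fun k => ?_).trans ?_
  · rw [norm_mul, norm_pow, pow_add, pow_add, div_pow]
    have : ‖v‖ ^ k ≤ 2 ^ k := by gcongr
    calc ‖p (k + n)‖ * (‖v‖ ^ k * ‖v‖ ^ n) ≤ ‖p (k + n)‖ * (2 ^ k * ‖v‖ ^ n) := by gcongr
      _ = _ := by field_simp
  · rw [tsum_mul_right]
    refine mul_le_mul_of_nonneg_right ?_ (by positivity)
    have := hs.sum_add_tsum_nat_add n
    have h0 : 0 ≤ ∑ k ∈ Finset.range n, ‖p k‖ * (2 : ℝ) ^ k := by positivity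
    linarith

theorem integral_ofReal_pow (m : ℕ) :
    ∫ u in (1 / 2 : ℝ)..1, (u : ℂ) ^ m = (1 - (1 / 2) ^ (m + 1)) / ((m + 1 : ℕ) : ℂ) := by
  have h : ∀ u : ℝ, (u : ℂ) ^ m = ((u ^ m : ℝ) : ℂ) := fun u => by push_cast; rfl
  simp_rw [h]
  rw [intervalIntegral.integral_ofReal, integral_pow]
  push_cast
  simp

theorem hasSum_mul_log_one_sub {p : ℕ → ℂ} {f : ℂ → ℂ}
    (hp : ∀ z, HasSum (fun k => p k * z ^ k) (f z)) {z : ℂ} (hz : ‖z‖ < 1) :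
    HasSum (fun n => (-∑ k ∈ Finset.range n, p k / ((n - k : ℕ) : ℂ)) * z ^ n)
      (f z * log (1 - z)) := by
  have hl := hasSum_taylorSeries_neg_log hz
  have hl' : Summable fun n : ℕ => ‖z ^ n / (n : ℂ)‖ := hl.summable.norm
  have hprod := (summable_norm_sum_mul_antidiagonal_of_summable_norm
    (hp z).summable.norm hl').of_norm.hasSum
  rw [← tsum_mul_tsum_eq_tsum_sum_antidiagonal_of_summable_norm (hp z).summable.norm hl',
    (hp z).tsum_eq, hl.tsum_eq] at hprod
  have h := hprod.neg
  rw [mul_neg, neg_neg] at h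
  refine h.congr_fun fun n => ?_
  rw [Finset.Nat.sum_antidiagonal_eq_sum_range_succ
    (fun k l => p k * z ^ k * (z ^ l / (l : ℂ))), Finset.sum_range_succ]
  simp only [Nat.sub_self, Nat.cast_zero, div_zero, mul_zero, add_zero]
  rw [neg_mul, Finset.sum_mul]
  congr 1
  refine Finset.sum_congr rfl fun k hk => ?_
  have : n = k + (n - k) := by have := Finset.mem_range.1 hk; omega
  rw [show z ^ n = z ^ k * z ^ (n - k) by rw [← pow_add, ← this]]
  ring

theorem norm_integral_sub_sum_le {p : ℕ → ℂ} {f : ℂ → ℂ} (hf : Differentiable ℂ f)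
    (hp : ∀ z, HasSum (fun k => p k * z ^ k) (f z)) (n : ℕ) :
    ‖(∫ u in (1 / 2 : ℝ)..1, f (u : ℂ)⁻¹ * (u : ℂ)⁻¹ * (u : ℂ) ^ n) -
      ∑ k ∈ Finset.range n, p k / ((n - k : ℕ) : ℂ)‖ ≤
      2 * (∑' k, ‖p k‖ * 2 ^ k) * (1 / 2) ^ n := by
  set M := ∑' k, ‖p k‖ * (2 : ℝ) ^ k with hM
  have hs : Summable fun k => ‖p k‖ * (2 : ℝ) ^ k := by simpa using (hp 2).summable.norm
  have hI : Set.uIcc (1 / 2 : ℝ) 1 = Set.Icc (1 / 2) 1 := Set.uIcc_of_le (by norm_num)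
  have hinv : ContinuousOn (fun u : ℝ => (u : ℂ)⁻¹) (Set.uIcc (1 / 2) 1) := by
    refine continuous_ofReal.continuousOn.inv₀ fun u hu => ?_
    rw [hI] at hu
    exact_mod_cast (by linarith [hu.1] : u ≠ 0)
  have hint : IntervalIntegrable (fun u : ℝ => f (u : ℂ)⁻¹ * (u : ℂ)⁻¹ * (u : ℂ) ^ n) volume
      (1 / 2) 1 := by
    refine ContinuousOn.intervalIntegrable (((hf.continuous.comp_continuousOn hinv).mul hinv).mul ?_)
    fun_prop
  have hint' : IntervalIntegrable
      (fun u : ℝ => ∑ k ∈ Finset.range n, p k * (u : ℂ) ^ (n - 1 - k)) volume (1 / 2) 1 :=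
    Continuous.intervalIntegrable (by fun_prop) _ _
  have hsum : ∫ u in (1 / 2 : ℝ)..1, ∑ k ∈ Finset.range n, p k * (u : ℂ) ^ (n - 1 - k) =
      ∑ k ∈ Finset.range n, p k / ((n - k : ℕ) : ℂ) -
        ∑ k ∈ Finset.range n, p k * (1 / 2) ^ (n - k) / ((n - k : ℕ) : ℂ) := by
    rw [intervalIntegral.integral_finsetSum fun k _ =>
      Continuous.intervalIntegrable (by fun_prop) _ _, ← Finset.sum_sub_distrib]
    refine Finset.sum_congr rfl fun k hk => ?_
    rw [intervalIntegral.integral_const_mul, integral_ofReal_pow,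
      show n - 1 - k + 1 = n - k by have := Finset.mem_range.1 hk; omega]
    ring
  have hpt : ‖∫ u in (1 / 2 : ℝ)..1, (f (u : ℂ)⁻¹ * (u : ℂ)⁻¹ * (u : ℂ) ^ n -
      ∑ k ∈ Finset.range n, p k * (u : ℂ) ^ (n - 1 - k))‖ ≤
      (2 * M * (1 / 2) ^ n) * |1 - 1 / 2| := by
    refine intervalIntegral.norm_integral_le_of_norm_le_const fun u hu => ?_
    rw [Set.uIoc_of_le (by norm_num)] at hu
    have hu0 : 0 < u := by linarith [hu.1]
    have huc : (u : ℂ) ≠ 0 := by exact_mod_cast hu0.ne'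
    have hu2 : u⁻¹ ≤ 2 := by
      rw [inv_le_comm₀ hu0 two_pos]; linarith [hu.1]
    have hnu : ‖(u : ℂ)⁻¹‖ = u⁻¹ := by simp [abs_of_pos hu0]
    have hb := norm_sub_sum_range_le hp (hnu.le.trans hu2) n
    have heq : f (u : ℂ)⁻¹ * (u : ℂ)⁻¹ * (u : ℂ) ^ n -
        ∑ k ∈ Finset.range n, p k * (u : ℂ) ^ (n - 1 - k) =
        (f (u : ℂ)⁻¹ - ∑ k ∈ Finset.range n, p k * (u : ℂ)⁻¹ ^ k) * ((u : ℂ)⁻¹ * (u : ℂ) ^ n) := by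
      rw [sub_mul, Finset.sum_mul, mul_assoc]
      congr 1
      refine Finset.sum_congr rfl fun k hk => ?_
      obtain ⟨m, rfl⟩ : ∃ m, n = k + m + 1 :=
        ⟨n - 1 - k, by have := Finset.mem_range.1 hk; omega⟩
      rw [show k + m + 1 - 1 - k = m by omega, inv_pow]
      field_simp
      ring
    rw [heq, norm_mul, norm_mul, norm_pow, hnu, norm_real, Real.norm_of_nonneg hu0.le]
    rw [hnu] at hb
    have hM0 : 0 ≤ M := tsum_nonneg fun k => by positivity
    calc _ ≤ (M * (u⁻¹ / 2) ^ n) * (u⁻¹ * u ^ n) := by gcongr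
      _ = M * (1 / 2) ^ n * u⁻¹ := by
          rw [div_pow, inv_pow, div_pow]
          field_simp
          simp
      _ ≤ M * (1 / 2) ^ n * 2 := by gcongr
      _ = _ := by ring
  have htail : ‖∑ k ∈ Finset.range n, p k * (1 / 2) ^ (n - k) / ((n - k : ℕ) : ℂ)‖ ≤
      M * (1 / 2) ^ n := by
    refine (norm_sum_le _ _).trans ?_
    calc _ ≤ ∑ k ∈ Finset.range n, ‖p k‖ * 2 ^ k * (1 / 2) ^ n := by
          refine Finset.sum_le_sum fun k hk => ?_
          have hk' := Finset.mem_range.1 hk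
          have h1 : (1 : ℝ) ≤ ((n - k : ℕ) : ℝ) := by
            exact_mod_cast (by omega : 1 ≤ n - k)
          have h2 : (1 / 2 : ℝ) ^ n = (1 / 2) ^ (n - k) * (1 / 2) ^ k := by
            rw [← pow_add]; congr 1; omega
          have h3 : (2 : ℝ) ^ k * (1 / 2) ^ k = 1 := by rw [← mul_pow]; norm_num
          rw [norm_div, norm_mul, norm_pow, Complex.norm_natCast]
          refine (div_le_self (by positivity) h1).trans_eq ?_
          rw [h2]
          calc _ = ‖p k‖ * (1 / 2 : ℝ) ^ (n - k) * (2 ^ k * (1 / 2) ^ k) := by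
                rw [h3]; norm_num
            _ = _ := by ring
      _ = (∑ k ∈ Finset.range n, ‖p k‖ * 2 ^ k) * (1 / 2) ^ n := by rw [Finset.sum_mul]
      _ ≤ _ := by
          gcongr
          exact hs.sum_le_tsum _ fun k _ => by positivity
  rw [intervalIntegral.integral_sub hint hint', hsum] at hpt
  have h12 : |(1 : ℝ) - 1 / 2| = 1 / 2 := by norm_num
  rw [h12] at hpt
  rw [← sub_add] at hpt
  have htri := norm_sub_le_of_le hpt htail
  rw [add_sub_cancel_right] at htri
  exact htri.trans_eq (by ring)

/-- Coefficients of `A / (1 - z) + f(z) log (1 - z)` with `f` entire. -/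
theorem exists_norm_coeff_sub_integral_le {f : ℂ → ℂ} (hf : Differentiable ℂ f) {A : ℂ}
    {a : ℕ → ℂ}
    (ha : ∀ z : ℂ, ‖z‖ < 1 → HasSum (fun n => a n * z ^ n) (A / (1 - z) + f z * log (1 - z))) :
    ∃ ψ : ℝ → ℂ, ContinuousOn ψ (Set.Icc (1 / 2) 1) ∧ ∃ M : ℝ, ∀ n,
      ‖a n - A - ∫ u in (1 / 2 : ℝ)..1, ψ u * (u : ℂ) ^ n‖ ≤ M * (1 / 2) ^ n := by
  obtain ⟨p, hp⟩ : ∃ p : ℕ → ℂ, ∀ z, HasSum (fun k => p k * z ^ k) (f z) := by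
    refine ⟨fun k => (k.factorial : ℂ)⁻¹ * iteratedDeriv k f 0, fun z => ?_⟩
    refine (hasSum_taylorSeries_of_entire hf 0 z).congr_fun fun k => ?_
    simp only [sub_zero, smul_eq_mul]
    ring
  have hinv : ContinuousOn (fun u : ℝ => (u : ℂ)⁻¹) (Set.Icc (1 / 2) 1) := by
    refine continuous_ofReal.continuousOn.inv₀ fun u hu => ?_
    exact_mod_cast (by linarith [hu.1] : u ≠ 0)
  refine ⟨fun u => -(f (u : ℂ)⁻¹ * (u : ℂ)⁻¹),
    ((hf.continuous.comp_continuousOn hinv).mul hinv).neg, _,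
    fun n => le_trans (le_of_eq ?_) (norm_integral_sub_sum_le hf hp n)⟩
  have hcoeff : a = fun n => A + -∑ k ∈ Finset.range n, p k / ((n - k : ℕ) : ℂ) := by
    refine eq_of_hasSum_mul_pow ha fun z hz => ?_
    have hgeo := (hasSum_geometric_of_norm_lt_one hz).mul_left A
    rw [← div_eq_mul_inv] at hgeo
    exact (hgeo.add (hasSum_mul_log_one_sub hp hz)).congr_fun fun n => by ring
  rw [hcoeff]
  simp only [neg_mul, intervalIntegral.integral_neg]
  congr 1
  ring

/-- Repeated application of `z d/dz` turns a logarithmic singularity into a simple pole. -/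
theorem exists_tendsto_one_sub_mul_powSum_pow_mul (m : ℕ) {b : ℕ → ℂ}
    (hb : ConvergesOnUnitDisk b) {u v : ℂ → ℂ} (hu : AnalyticAt ℂ u 1) (hu1 : u 1 ≠ 0)
    (hv : AnalyticAt ℂ v 1)
    (h : ∀ᶠ t : ℝ in 𝓝[<] 1,
      powSum b t = ((t : ℂ) - 1) ^ m * u t * (Real.log (1 - t) : ℂ) + v t) :
    ∃ k : ℕ, ∃ c : ℂ, c ≠ 0 ∧
      Tendsto (fun t : ℝ => (1 - (t : ℂ)) * powSum (fun n => (n : ℂ) ^ k * b n) t)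
        (𝓝[<] 1) (𝓝 c) := by
  have hlog : ∀ t : ℝ, t < 1 →
      HasDerivAt (fun t : ℝ => (Real.log (1 - t) : ℂ)) (-(1 / (1 - (t : ℂ)))) t := by
    intro t ht
    have h1 : HasDerivAt (fun t : ℝ => 1 - t) (-1) t := (hasDerivAt_id t).const_sub 1
    have h2 := (h1.log (by linarith)).ofReal_comp
    convert h2 using 1
    push_cast
    ring
  have hev : ∀ᶠ t : ℝ in 𝓝[<] 1, t < 1 ∧ AnalyticAt ℂ u t ∧ AnalyticAt ℂ v t := by
    filter_upwards [self_mem_nhdsWithin,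
      tendsto_ofReal_nhdsLT_one.eventually hu.eventually_analyticAt,
      tendsto_ofReal_nhdsLT_one.eventually hv.eventually_analyticAt] with t h1 h2 h3
      using ⟨h1, h2, h3⟩
  induction m generalizing b u v with
  | zero =>
    refine ⟨1, -u 1, neg_ne_zero.2 hu1, ?_⟩
    have hder := hb.powSum_nat_mul_of_eventuallyEq
      (f := fun t : ℝ => u t * (Real.log (1 - t) : ℂ) + v t)
      (f' := fun t : ℝ => deriv u t * (Real.log (1 - t) : ℂ) + u t * -(1 / (1 - (t : ℂ))) +
        deriv v t) (by simpa using h) (by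
        filter_upwards [hev] with t ht
        exact (ht.2.1.differentiableAt.hasDerivAt.comp_ofReal.mul (hlog t ht.1)).add
          ht.2.2.differentiableAt.hasDerivAt.comp_ofReal)
    have hT := tendsto_ofReal_nhdsLT_one
    have lim := ((hT.mul (hu.deriv.continuousAt.tendsto.comp hT)).mul
      tendsto_one_sub_mul_log).sub (hT.mul (hu.continuousAt.tendsto.comp hT)) |>.add
      ((hT.mul (hv.deriv.continuousAt.tendsto.comp hT)).mul tendsto_one_sub_nhdsLT_one)
    simp only [mul_zero, one_mul, zero_sub, add_zero] at lim
    refine lim.congr' ?_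
    filter_upwards [hder, hev] with t ht ht'
    have hne : (1 - (t : ℂ)) ≠ 0 := by
      rw [← ofReal_one, ← ofReal_sub]
      exact_mod_cast (sub_pos.2 ht'.1).ne'
    simp only [pow_one, ht, Function.comp_apply]
    field_simp
    ring
  | succ m ih =>
    set u' : ℂ → ℂ := fun z => z * ((m + 1) * u z + (z - 1) * deriv u z) with hu'
    set v' : ℂ → ℂ := fun z => z * ((z - 1) ^ m * u z + deriv v z) with hv'
    have hid : AnalyticAt ℂ (fun z : ℂ => z - 1) 1 := analyticAt_id.sub analyticAt_const
    have hau : AnalyticAt ℂ u' 1 :=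
      analyticAt_id.mul ((analyticAt_const.mul hu).add (hid.mul hu.deriv))
    have hav : AnalyticAt ℂ v' 1 := analyticAt_id.mul (((hid.pow m).mul hu).add hv.deriv)
    have hder := hb.powSum_nat_mul_of_eventuallyEq
      (f' := fun t : ℝ => ((m + 1) * ((t : ℂ) - 1) ^ m * u t + ((t : ℂ) - 1) ^ (m + 1) *
        deriv u t) * (Real.log (1 - t) : ℂ) +
        ((t : ℂ) - 1) ^ (m + 1) * u t * -(1 / (1 - (t : ℂ))) + deriv v t) h (by
        filter_upwards [hev] with t ht
        have hp : HasDerivAt (fun z : ℂ => (z - 1) ^ (m + 1)) ((m + 1) * ((t : ℂ) - 1) ^ m) t := by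
          simpa using ((hasDerivAt_id (t : ℂ)).sub_const 1).fun_pow (m + 1)
        exact ((hp.mul ht.2.1.differentiableAt.hasDerivAt).comp_ofReal.mul (hlog t ht.1)).add
          ht.2.2.differentiableAt.hasDerivAt.comp_ofReal)
    have hu'1 : u' 1 ≠ 0 := by
      simpa [hu'] using ⟨by exact_mod_cast m.succ_ne_zero, hu1⟩
    obtain ⟨k, c, hc, hk⟩ := ih hb.nat_mul hau hu'1 hav (by
      filter_upwards [hder, hev] with t ht ht'
      have hne : (1 - (t : ℂ)) ≠ 0 := by
        rw [← ofReal_one, ← ofReal_sub]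
        exact_mod_cast (sub_pos.2 ht'.1).ne'
      simp only [ht, hu', hv']
      field_simp
      ring) (by
      filter_upwards [self_mem_nhdsWithin,
        tendsto_ofReal_nhdsLT_one.eventually hau.eventually_analyticAt,
        tendsto_ofReal_nhdsLT_one.eventually hav.eventually_analyticAt] with t h1 h2 h3
        using ⟨h1, h2, h3⟩)
    exact ⟨k + 1, c, hc, by simpa only [pow_succ, mul_assoc] using hk⟩

theorem ConvergesOnUnitDisk.pow_mul {b : ℕ → ℂ} (hb : ConvergesOnUnitDisk b) (k : ℕ) :
    ConvergesOnUnitDisk fun n => (n : ℂ) ^ k * b n := by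
  induction k with
  | zero => simpa using hb
  | succ k ih => simpa only [pow_succ', mul_assoc] using ih.nat_mul

theorem ContinuesAtOne.pow_mul {d : ℕ → ℂ} (h : ContinuesAtOne d) (hd : ConvergesOnUnitDisk d)
    (k : ℕ) : ContinuesAtOne fun n => (n : ℂ) ^ k * d n := by
  induction k with
  | zero => simpa using h
  | succ k ih => simpa only [pow_succ', mul_assoc] using ih.nat_mul (hd.pow_mul k)

/-- A nontrivial simple singularity becomes a simple pole after applying a power of `z d/dz`. -/
theorem exists_tendsto_of_simple_singularity {b : ℕ → ℂ} (hb : ConvergesOnUnitDisk b) {B : ℂ}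
    {g₁ g₂ : ℂ → ℂ} (hg₁ : AnalyticAt ℂ g₁ 1) (hg₂ : AnalyticAt ℂ g₂ 1)
    (h : ∀ᶠ t : ℝ in 𝓝[<] 1,
      powSum b t = B / (1 - (t : ℂ)) + g₁ t * (Real.log (1 - t) : ℂ) + g₂ t)
    (hne : B ≠ 0 ∨ ¬ ∀ᶠ z in 𝓝 1, g₁ z = 0) :
    ∃ k : ℕ, ∃ c : ℂ, c ≠ 0 ∧
      Tendsto (fun t : ℝ => (1 - (t : ℂ)) * powSum (fun n => (n : ℂ) ^ k * b n) t)
        (𝓝[<] 1) (𝓝 c) := by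
  have hT := tendsto_ofReal_nhdsLT_one
  by_cases hB : B = 0
  · obtain ⟨m, u, hu, hu1, hm⟩ := hg₁.exists_eventuallyEq_pow_smul_nonzero_iff.2
      (hne.resolve_left (not_not.2 hB))
    refine exists_tendsto_one_sub_mul_powSum_pow_mul m hb hu hu1 hg₂ ?_
    filter_upwards [h, hT.eventually hm] with t ht ht'
    rw [ht, ht', hB, smul_eq_mul]
    ring
  · refine ⟨0, B, hB, ?_⟩
    have lim := (((hg₁.continuousAt.tendsto.comp hT).mul tendsto_one_sub_mul_log).const_add B).add
      ((hg₂.continuousAt.tendsto.comp hT).mul tendsto_one_sub_nhdsLT_one)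
    simp only [mul_zero, add_zero] at lim
    refine lim.congr' ?_
    filter_upwards [h, self_mem_nhdsWithin] with t ht ht'
    have hne : (1 - (t : ℂ)) ≠ 0 := by
      rw [← ofReal_one, ← ofReal_sub]
      exact_mod_cast (sub_pos.2 (ht' : t < 1)).ne'
    simp only [pow_zero, one_mul, ht, Function.comp_apply]
    field_simp

/-- If `F(ζ) = A/(1−ζ) + f₁(ζ)log(1−ζ)/(2πi)` with `A ≠ 0`, and `g` (holomorphic on the
slit disk `U`) has a simple singularity at `1` that does not vanish (`B ≠ 0` or `g₁ ≢ 0`),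
then the Hadamard product `h(ζ) = Σ a_n b_n ζ^n` is singular at `1`. -/
theorem stmt1 (ε r : ℝ) (hε : ε ∈ Set.Ioo (0 : ℝ) 1) (hr : r ∈ Set.Ioo (0 : ℝ) 1)
    (f₁ : ℂ → ℂ) (hf₁ : Differentiable ℂ f₁) (A : ℂ) (hA : A ≠ 0)
    (a : ℕ → ℂ)
    (ha : ∀ ζ : ℂ, ‖ζ‖ < 1 → HasSum (fun n => a n * ζ ^ n)
      (A / (1 - ζ) + f₁ ζ * Complex.log (1 - ζ) / (2 * Real.pi * I)))
    (U : Set ℂ) (hU : U = ball (0 : ℂ) (1 + ε) \ (Complex.ofReal '' Set.Ico 1 (1 + ε)))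
    (g : ℂ → ℂ) (hg : DifferentiableOn ℂ g U)
    (b : ℕ → ℂ) (hb : ∀ ζ : ℂ, ‖ζ‖ < 1 → HasSum (fun n => b n * ζ ^ n) (g ζ))
    (B : ℂ) (g₁ g₂ : ℂ → ℂ)
    (hg₁ : DifferentiableOn ℂ g₁ (ball (1 : ℂ) r))
    (hg₂ : DifferentiableOn ℂ g₂ (ball (1 : ℂ) r))
    (hrep : ∀ ζ ∈ ball (1 : ℂ) r, ζ ∈ U → ζ ∉ Complex.ofReal '' Set.Ici 1 →
      g ζ = B / (1 - ζ) + g₁ ζ * Complex.log (1 - ζ) / (2 * Real.pi * I) + g₂ ζ)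
    (hnontriv : B ≠ 0 ∨ ∃ ζ ∈ ball (1 : ℂ) r, g₁ ζ ≠ 0) :
    (∀ ζ : ℂ, ‖ζ‖ < 1 → Summable (fun n => a n * b n * ζ ^ n)) ∧
    ¬ ∃ δ > 0, ∃ H : ℂ → ℂ, DifferentiableOn ℂ H (ball (1 : ℂ) δ) ∧
      ∀ x : ℝ, 1 - δ < x → x < 1 → H x = ∑' n, a n * b n * (x : ℂ) ^ n := by
  have hca : ConvergesOnUnitDisk a := fun z hz => (ha z hz).summable
  have hcb : ConvergesOnUnitDisk b := fun z hz => (hb z hz).summable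
  have hcab := hca.hadamard hcb
  refine ⟨hcab, ?_⟩
  rintro ⟨δ, hδ, H, hH, he⟩
  have hcont : ContinuesAtOne fun n => a n * b n := by
    refine ⟨H, hH.analyticAt (ball_mem_nhds _ hδ), ?_⟩
    have h1 : ∀ᶠ t : ℝ in 𝓝[<] 1, 1 - δ < t :=
      (lt_mem_nhds (by linarith)).filter_mono nhdsWithin_le_nhds
    filter_upwards [h1, self_mem_nhdsWithin] with t h1 h2 using (he t h1 h2).symm
  obtain ⟨ψ, hψ, M, hM⟩ := exists_norm_coeff_sub_integral_le
    (f := fun z => f₁ z / (2 * Real.pi * I)) (by fun_prop) (A := A) (a := a) (fun z hz => by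
      simpa only [div_mul_eq_mul_div] using ha z hz)
  have han₁ : AnalyticAt ℂ g₁ 1 := hg₁.analyticAt (ball_mem_nhds _ hr.1)
  have han₂ : AnalyticAt ℂ g₂ 1 := hg₂.analyticAt (ball_mem_nhds _ hr.1)
  obtain ⟨k, c, hc, hk⟩ := exists_tendsto_of_simple_singularity hcb (B := B)
    (g₁ := fun z => g₁ z / (2 * Real.pi * I)) (han₁.div analyticAt_const two_pi_I_ne_zero) han₂
    (by
      have hlt : ∀ᶠ t : ℝ in 𝓝[<] 1, 1 - r < t :=
        (lt_mem_nhds (by linarith [hr.1])).filter_mono nhdsWithin_le_nhds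
      filter_upwards [hlt, self_mem_nhdsWithin] with t h1 h2
      have h2' : t < 1 := h2
      have ht0 : 0 < t := by linarith [hr.2]
      have hn : ‖(t : ℂ)‖ < 1 := by simpa [abs_of_pos ht0] using h2'
      have hball : (t : ℂ) ∈ ball (1 : ℂ) r := by
        rw [mem_ball, dist_eq, ← ofReal_one, ← ofReal_sub, norm_real, Real.norm_eq_abs, abs_lt]
        constructor <;> linarith
      have hUt : (t : ℂ) ∈ U := by
        rw [hU]
        refine ⟨by rw [mem_ball_zero_iff]; linarith [hε.1], ?_⟩
        rintro ⟨s, hs, hst⟩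
        rw [ofReal_inj] at hst
        linarith [hs.1]
      have hrt := hrep t hball hUt (by
        rintro ⟨s, hs, hst⟩
        rw [ofReal_inj] at hst
        linarith [Set.mem_Ici.1 hs])
      rw [powSum, (hb t hn).tsum_eq, hrt, ofReal_log (by linarith)]
      push_cast
      ring)
    (hnontriv.imp id fun ⟨ζ, hζ, hne⟩ h0 => hne <|
      (hg₁.analyticOnNhd isOpen_ball).eqOn_zero_of_preconnected_of_eventuallyEq_zero
        (convex_ball _ _).isPreconnected (mem_ball_self hr.1)
        (h0.mono fun z hz => (div_eq_zero_iff.1 hz).resolve_right two_pi_I_ne_zero) hζ)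
  have lim := tendsto_one_sub_mul_powSum_hadamard (hcb.pow_mul k) hk hψ hM
  have lim0 := (hcont.pow_mul hcab k).tendsto_one_sub_mul
  simp only [mul_left_comm ((_ : ℂ) ^ k)] at lim0
  exact mul_ne_zero hA hc (tendsto_nhds_unique lim lim0)
end

section
/- Fix ε, r ∈ (0,1) and M ≥ 1. Let f₁ : ℂ → ℂ be entire and let F(ζ) = f₁(ζ)·log(1−ζ)/(2πi), holomorphic on the unit disk, with Taylor coefficients (a_n)_{n≥0} at 0. Let U = {ζ ∈ ℂ : |ζ| < 1+ε} ∖ [1, 1+ε) and let g : U → ℂ be holomorphic, with Taylor coefficients (b_n)_{n≥0} at 0, and suppose there exist A_1, …, A_M ∈ ℂ with A_M ≠ 0 and functions φ₁, φ₂ holomorphic on the disk D(1,r) such that g(ζ) = Σ_{j=1}^M A_j/(1−ζ)^j + φ₁(ζ)·log(1−ζ)/(2πi) + φ₂(ζ) for all ζ ∈ D(1,r) with ζ ∉ [1,∞). Then the Hadamard product series h(ζ) = Σ_{n≥0} a_n b_n ζ^n converges for |ζ| < 1, and lim_{ζ→1⁻, ζ∈(0,1)} (ζ−1)^M · h(ζ)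 = 0. -/
open Metric Complex Filter

theorem hasSum_of_forall_eq {f g : ℕ → ℂ} {s : ℂ} (hf : HasSum f s) (hfg : ∀ n, f n = g n) :
    HasSum g s :=
  funext hfg ▸ hf

/-- **Cauchy's coefficient estimate** for the sum of a power series on the unit disk. -/
theorem norm_coeff_mul_pow_le_of_hasSum {c : ℕ → ℂ} {R : ℂ → ℂ}
    (hc : ∀ ζ : ℂ, ‖ζ‖ < 1 → HasSum (fun n => c n * ζ ^ n) (R ζ)) {ρ B : ℝ}
    (hρ : 0 < ρ) (hρ1 : ρ < 1) (hB : ∀ ζ : ℂ, ‖ζ‖ = ρ → ‖R ζ‖ ≤ B) (n : ℕ) :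
    ‖c n‖ * ρ ^ n ≤ B := by
  have hp : HasFPowerSeriesOnBall R (FormalMultilinearSeries.ofScalars ℂ c) 0 1 := by
    refine ⟨?_, one_pos, ?_⟩
    · refine ENNReal.le_of_forall_nnreal_lt fun s hs => ?_
      refine FormalMultilinearSeries.le_radius_of_summable _ ?_
      have hs1 : (s : ℝ) < 1 := by exact_mod_cast hs
      have := (hc (s : ℂ) (by simpa using hs1)).summable.norm
      simpa [FormalMultilinearSeries.ofScalars_norm] using this
    · intro y hy
      have hy1 : ‖y‖ < 1 := by
        have : y ∈ eball (0 : ℂ) ((1 : NNReal) : ENNReal) := by simpa using hy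
        rw [Metric.eball_coe] at this
        simpa using this
      simpa [FormalMultilinearSeries.ofScalars_apply_eq, mul_comm] using hc y hy1
  have hsub : closedBall (0 : ℂ) ρ ⊆ eball (0 : ℂ) 1 := by
    intro y hy
    have : y ∈ ball (0 : ℂ) ((1 : NNReal) : ℝ) := by
      simp only [mem_closedBall, dist_zero_right, NNReal.coe_one, mem_ball] at hy ⊢
      linarith
    rw [← Metric.eball_coe] at this
    simpa using this
  lift ρ to NNReal using hρ.le
  have hq := ((hp.differentiableOn.mono hsub).hasFPowerSeriesOnBall (by exact_mod_cast hρ))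
  have heq := hp.hasFPowerSeriesAt.eq_formalMultilinearSeries hq.hasFPowerSeriesAt
  have h1 := norm_cauchyPowerSeries_le R 0 ρ n
  rw [← heq, FormalMultilinearSeries.ofScalars_norm] at h1
  have h2 : ∫ θ in (0 : ℝ)..2 * Real.pi, ‖R (circleMap 0 ρ θ)‖ ≤ B * (2 * Real.pi) := by
    have := intervalIntegral.norm_integral_le_of_norm_le_const (a := 0) (b := 2 * Real.pi) (C := B)
      (f := fun θ => ‖R (circleMap 0 ρ θ)‖) (fun θ _ => by
        rw [norm_norm]; exact hB _ (by simp [circleMap]))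
    rw [sub_zero, abs_of_pos Real.two_pi_pos] at this
    exact (le_abs_self _).trans this
  have h3 : (2 * Real.pi)⁻¹ * ∫ θ in (0 : ℝ)..2 * Real.pi, ‖R (circleMap 0 ρ θ)‖ ≤ B := by
    rw [inv_mul_le_iff₀ Real.two_pi_pos]; linarith
  rw [abs_of_pos hρ] at h1
  have h4 := h1.trans (mul_le_mul_of_nonneg_right h3 (by positivity))
  rwa [inv_pow, ← div_eq_mul_inv, le_div_iff₀ (by positivity)] at h4

/-- The Taylor coefficients of an entire multiple of `log (1 - ζ)` are `O(1 / n)`. -/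
theorem exists_bound_coeff_entire_mul_log {f₁ : ℂ → ℂ} (hf₁ : Differentiable ℂ f₁) {a : ℕ → ℂ}
    (ha : ∀ ζ : ℂ, ‖ζ‖ < 1 → HasSum (fun n => a n * ζ ^ n)
      (f₁ ζ * Complex.log (1 - ζ) / (2 * Real.pi * I))) :
    ∃ S : ℝ, 0 ≤ S ∧ ∀ n : ℕ, ‖a n‖ * (n + 1) ≤ S := by
  obtain ⟨c, hc⟩ : ∃ c : ℕ → ℂ, ∀ z, HasSum (fun n => c n * z ^ n) (f₁ z) := by
    refine ⟨fun n => (n.factorial : ℂ)⁻¹ * iteratedDeriv n f₁ 0, fun z => ?_⟩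
    refine hasSum_of_forall_eq (Complex.hasSum_taylorSeries_of_entire hf₁ 0 z) fun n => ?_
    simp only [sub_zero, smul_eq_mul]; ring
  have hc2 : Summable fun n => ‖c n‖ * 2 ^ n := by simpa using (hc 2).summable.norm
  set e : ℕ → ℂ := fun n =>
    ∑ kl ∈ Finset.HasAntidiagonal.antidiagonal n, c kl.1 * (-(kl.2 : ℂ)⁻¹ / (2 * Real.pi * I))
    with he
  have hsum : ∀ ζ : ℂ, ‖ζ‖ < 1 → HasSum (fun n => e n * ζ ^ n)
      (f₁ ζ * Complex.log (1 - ζ) / (2 * Real.pi * I)) := by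
    intro ζ hζ
    have h1 := hc ζ
    have h2 : HasSum (fun n : ℕ => -(n : ℂ)⁻¹ / (2 * Real.pi * I) * ζ ^ n)
        (Complex.log (1 - ζ) / (2 * Real.pi * I)) := by
      have h := (Complex.hasSum_taylorSeries_neg_log hζ).neg.div_const (2 * Real.pi * I)
      rw [neg_neg] at h
      refine hasSum_of_forall_eq h fun n => ?_
      ring
    have h3 := summable_norm_sum_mul_antidiagonal_of_summable_norm h1.summable.norm h2.summable.norm
    have h4 := tsum_mul_tsum_eq_tsum_sum_antidiagonal_of_summable_norm
      h1.summable.norm h2.summable.norm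
    rw [h1.tsum_eq, h2.tsum_eq] at h4
    have h5 := h3.of_norm.hasSum
    rw [← h4, ← mul_div_assoc] at h5
    refine hasSum_of_forall_eq h5 fun n => ?_
    simp only [he, Finset.sum_mul]
    refine Finset.sum_congr rfl fun kl hkl => ?_
    rw [← Finset.HasAntidiagonal.mem_antidiagonal.mp hkl, pow_add]; ring
  have hae : ∀ n, a n = e n := by
    intro n
    have := norm_coeff_mul_pow_le_of_hasSum (c := fun n => a n - e n) (R := 0) (ρ := 1 / 2) (B := 0)
      (fun ζ hζ => by simpa [sub_mul] using (ha ζ hζ).sub (hsum ζ hζ)) (by norm_num) (by norm_num)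
      (by simp) n
    have h0 : ‖a n - e n‖ ≤ 0 := by
      by_contra! h
      have : 0 < ‖a n - e n‖ * (1 / 2 : ℝ) ^ n := by positivity
      linarith
    exact sub_eq_zero.mp (norm_le_zero_iff.mp h0)
  refine ⟨2 * ∑' n, ‖c n‖ * 2 ^ n, by positivity, fun n => ?_⟩
  have hterm : ∀ kl ∈ Finset.HasAntidiagonal.antidiagonal n,
      ‖c kl.1 * (-(kl.2 : ℂ)⁻¹ / (2 * Real.pi * I))‖ * (n + 1) ≤ 2 * (‖c kl.1‖ * 2 ^ kl.1) := by
    rintro ⟨m, k⟩ hkl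
    obtain rfl := Finset.HasAntidiagonal.mem_antidiagonal.mp hkl
    have hpi : 1 ≤ 2 * Real.pi := by linarith [Real.pi_gt_three]
    have hm : (m : ℝ) + 1 ≤ 2 ^ m := by exact_mod_cast Nat.lt_two_pow_self
    simp only [norm_mul, norm_div, norm_neg, norm_inv, Complex.norm_natCast, Complex.norm_I,
      Complex.norm_ofNat, Complex.norm_real, Real.norm_eq_abs, abs_of_pos Real.pi_pos, mul_one]
    rcases Nat.eq_zero_or_pos k with rfl | hk
    · simp
    have hk1 : (1 : ℝ) ≤ k := by exact_mod_cast hk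
    have hkey : (k : ℝ)⁻¹ / (2 * Real.pi) * (((m + k : ℕ) : ℝ) + 1) ≤ 2 * 2 ^ m := by
      calc (k : ℝ)⁻¹ / (2 * Real.pi) * (((m + k : ℕ) : ℝ) + 1)
          ≤ (k : ℝ)⁻¹ * (((m + k : ℕ) : ℝ) + 1) := by
            gcongr
            exact div_le_self (by positivity) hpi
        _ ≤ 2 * (m + 1) := by
            rw [inv_mul_le_iff₀ (by positivity)]
            push_cast
            nlinarith [mul_nonneg (Nat.cast_nonneg (α := ℝ) m) (sub_nonneg.2 hk1)]
        _ ≤ 2 * 2 ^ m := by gcongr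
    calc _ = ‖c m‖ * ((k : ℝ)⁻¹ / (2 * Real.pi) * (((m + k : ℕ) : ℝ) + 1)) := by ring
      _ ≤ ‖c m‖ * (2 * 2 ^ m) := by gcongr
      _ = _ := by ring
  rw [hae]
  calc ‖e n‖ * (n + 1)
      ≤ (∑ kl ∈ Finset.HasAntidiagonal.antidiagonal n,
          ‖c kl.1 * (-(kl.2 : ℂ)⁻¹ / (2 * Real.pi * I))‖) * (n + 1) := by
        gcongr; exact norm_sum_le _ _
    _ ≤ ∑ kl ∈ Finset.HasAntidiagonal.antidiagonal n, 2 * (‖c kl.1‖ * 2 ^ kl.1) := by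
        rw [Finset.sum_mul]; exact Finset.sum_le_sum hterm
    _ = 2 * ∑ m ∈ Finset.range (n + 1), ‖c m‖ * 2 ^ m := by
        rw [← Finset.mul_sum, Finset.Nat.sum_antidiagonal_eq_sum_range_succ_mk]
    _ ≤ 2 * ∑' n, ‖c n‖ * 2 ^ n := by
        gcongr
        exact hc2.sum_le_tsum _ fun _ _ => by positivity

theorem norm_log_le_div_sqrt {w : ℂ} {δ : ℝ} (hδ : 0 < δ) (hδ1 : δ ≤ 1) (h1 : δ ≤ ‖w‖)
    (h2 : ‖w‖ ≤ 2) : ‖Complex.log w‖ ≤ 7 / √δ := by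
  have hs : 0 < √δ := Real.sqrt_pos.2 hδ
  have hs1 : √δ ≤ 1 := Real.sqrt_le_one.2 hδ1
  have hw : 0 < ‖w‖ := hδ.trans_le h1
  have hinv : 1 ≤ 1 / √δ := by rw [le_div_iff₀ hs]; linarith
  have hre : |Real.log ‖w‖| ≤ 2 / √δ := by
    rw [abs_le]
    constructor
    · have h3 : Real.log δ ≤ Real.log ‖w‖ := Real.log_le_log hδ h1
      have h4 : Real.log (1 / √δ) ≤ 1 / √δ := by
        have := Real.log_le_sub_one_of_pos (show 0 < 1 / √δ by positivity)
        linarith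
      rw [one_div, Real.log_inv, Real.log_sqrt hδ.le, ← one_div] at h4
      have : 2 / √δ = 2 * (1 / √δ) := by ring
      linarith
    · have h3 := Real.log_le_sub_one_of_pos hw
      have : 2 / √δ = 2 * (1 / √δ) := by ring
      linarith
  have him : |Complex.arg w| ≤ 4 / √δ := by
    have := Complex.abs_arg_le_pi w
    have h5 : 4 / √δ = 4 * (1 / √δ) := by ring
    linarith [Real.pi_le_four]
  have := Complex.norm_le_abs_re_add_abs_im (Complex.log w)
  rw [Complex.log_re, Complex.log_im] at this
  calc _ ≤ 2 / √δ + 4 / √δ := by linarith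
    _ ≤ 7 / √δ := by rw [← add_div]; gcongr; norm_num

/-- If `|R|` grows at most like `(1 - |ζ|) ^ (-1/2)`, its Taylor coefficients are `O(√n)`. -/
theorem norm_coeff_le_sqrt_of_growth {c : ℕ → ℂ} {R : ℂ → ℂ}
    (hc : ∀ ζ : ℂ, ‖ζ‖ < 1 → HasSum (fun n => c n * ζ ^ n) (R ζ)) {C : ℝ} (hC : 0 ≤ C)
    (hR : ∀ ζ : ℂ, ‖ζ‖ < 1 → ‖R ζ‖ ≤ C / √(1 - ‖ζ‖)) (n : ℕ) :
    ‖c n‖ ≤ 4 * C * √(n + 1) := by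
  have hn : (0 : ℝ) < n + 1 := by positivity
  set δ : ℝ := 1 / (2 * (n + 1)) with hδ
  have hδ0 : 0 < δ := by positivity
  have hδ2 : n * δ ≤ 1 / 2 := by
    rw [hδ, mul_one_div, div_le_div_iff₀ (by positivity) (by norm_num)]; linarith
  have hδ1 : δ ≤ 1 / 2 := by
    rw [hδ]; exact one_div_le_one_div_of_le (by norm_num) (by linarith)
  have h := norm_coeff_mul_pow_le_of_hasSum hc (ρ := 1 - δ) (B := C / √δ) (by linarith)
    (by linarith) (fun ζ hζ => by simpa [hζ] using hR ζ (by linarith)) n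
  have hb := one_add_mul_le_pow (a := -δ) (by linarith) n
  rw [← sub_eq_add_neg] at hb
  have hs : C / √δ ≤ 2 * C * √(n + 1) := by
    rw [hδ, Real.sqrt_div zero_le_one, Real.sqrt_one, div_div_eq_mul_div, div_one,
      Real.sqrt_mul zero_le_two]
    have : √(2 : ℝ) ≤ 2 := by rw [Real.sqrt_le_left] <;> norm_num
    have h' := mul_le_mul_of_nonneg_right this (mul_nonneg hC (Real.sqrt_nonneg ((n : ℝ) + 1)))
    nlinarith
  have : ‖c n‖ * (1 / 2) ≤ ‖c n‖ * (1 - δ) ^ n := by gcongr; nlinarith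
  linarith

/-- An Abelian theorem: coefficients dominated by `choose (n + k) k / √(n + 1)` give a sum
which is `o((1 - x) ^ (-(k + 1)))`. -/
theorem tendsto_pow_mul_tsum_of_norm_le {u : ℕ → ℂ} {k : ℕ} {K : ℝ} (hK : 0 ≤ K)
    (hu : ∀ n, ‖u n‖ ≤ K * ((n + k).choose k / √(n + 1))) :
    (∀ ζ : ℂ, ‖ζ‖ < 1 → Summable (fun n => u n * ζ ^ n)) ∧
    Tendsto (fun x : ℝ => ((x : ℂ) - 1) ^ (k + 1) * ∑' n, u n * (x : ℂ) ^ n)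
      (nhdsWithin 1 (Set.Ioo (0 : ℝ) 1)) (nhds 0) := by
  have hsum : ∀ ζ : ℂ, ‖ζ‖ < 1 → Summable (fun n => ‖u n * ζ ^ n‖) := by
    intro ζ hζ
    have hw := (hasSum_choose_mul_geometric_of_norm_lt_one k
      (show ‖(‖ζ‖ : ℝ)‖ < 1 by simpa using hζ)).summable.mul_left K
    refine Summable.of_nonneg_of_le (fun _ => norm_nonneg _) (fun n => ?_) hw
    rw [norm_mul, norm_pow, ← mul_assoc]
    gcongr
    refine (hu n).trans ?_
    gcongr
    refine div_le_self (by positivity) (Real.one_le_sqrt.2 ?_)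
    linarith [Nat.cast_nonneg (α := ℝ) n]
  refine ⟨fun ζ hζ => (hsum ζ hζ).of_norm, ?_⟩
  rw [Metric.tendsto_nhds]
  intro η hη
  obtain ⟨N, hN⟩ : ∃ N : ℕ, ∀ n ≥ N, ‖u n‖ ≤ η / 2 * (n + k).choose k := by
    obtain ⟨N, hN⟩ := exists_nat_gt ((K / (η / 2)) ^ 2)
    refine ⟨N, fun n hn => (hu n).trans ?_⟩
    have h1 : K / (η / 2) ≤ √(n + 1) := by
      refine Real.le_sqrt_of_sq_le ?_
      have : (N : ℝ) ≤ n := by exact_mod_cast hn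
      linarith
    rw [div_le_iff₀ (by positivity)] at h1
    rw [← mul_div_assoc, div_le_iff₀ (by positivity)]
    nlinarith [Nat.cast_nonneg (α := ℝ) ((n + k).choose k)]
  set B := ∑ n ∈ Finset.range N, ‖u n‖ with hB
  have hlim : Tendsto (fun x : ℝ => η / 2 + (1 - x) ^ (k + 1) * B)
      (nhdsWithin 1 (Set.Ioo (0 : ℝ) 1)) (nhds (η / 2)) := by
    have : Continuous fun x : ℝ => η / 2 + (1 - x) ^ (k + 1) * B := by fun_prop
    have h := (this.tendsto 1).mono_left (nhdsWithin_le_nhds (s := Set.Ioo (0 : ℝ) 1))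
    simpa using h
  filter_upwards [self_mem_nhdsWithin, hlim.eventually_lt_const (half_lt_self hη)] with x hx hxlt
  refine lt_of_le_of_lt ?_ hxlt
  have hx1 : ‖(x : ℂ)‖ < 1 := by
    rw [Complex.norm_real, Real.norm_eq_abs, abs_of_pos hx.1]; exact hx.2
  have hw := (hasSum_choose_mul_geometric_of_norm_lt_one k
      (show ‖x‖ < 1 by rw [Real.norm_eq_abs, abs_of_pos hx.1]; exact hx.2)).mul_left (η / 2)
  have hf := hasSum_sum_of_ne_finset_zero (L := SummationFilter.unconditional ℕ) (s := Finset.range N)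
    (f := fun n => if n < N then ‖u n‖ else 0) (fun n hn => if_neg (by simpa using hn))
  have hfB : ∑ n ∈ Finset.range N, (if n < N then ‖u n‖ else 0) = B :=
    Finset.sum_congr rfl fun n hn => if_pos (Finset.mem_range.1 hn)
  rw [hfB] at hf
  have hpos : 0 < 1 - x := by linarith [hx.2]
  have hx0 := hx.1
  have hbound : ‖∑' n, u n * (x : ℂ) ^ n‖ ≤ η / 2 * (1 / (1 - x) ^ (k + 1)) + B := by
    refine tsum_of_norm_bounded (hw.add hf) fun n => ?_
    rw [norm_mul, norm_pow, Complex.norm_real, Real.norm_eq_abs, abs_of_pos hx.1]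
    by_cases hn : n < N
    · rw [if_pos hn]
      have h1 : ‖u n‖ * x ^ n ≤ ‖u n‖ :=
        mul_le_of_le_one_right (norm_nonneg _) (pow_le_one₀ hx.1.le hx.2.le)
      have : 0 ≤ η / 2 * (((n + k).choose k : ℝ) * x ^ n) := by positivity
      linarith
    · rw [if_neg hn, add_zero, ← mul_assoc]
      gcongr
      exact hN n (not_lt.1 hn)
  have hnorm : ‖(x : ℂ) - 1‖ = 1 - x := by
    rw [← Complex.ofReal_one, ← Complex.ofReal_sub, Complex.norm_real, Real.norm_eq_abs,
      abs_sub_comm, abs_of_pos hpos]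
  rw [dist_zero_right, norm_mul, norm_pow, hnorm]
  calc _ ≤ (1 - x) ^ (k + 1) * (η / 2 * (1 / (1 - x) ^ (k + 1)) + B) := by gcongr
    _ = _ := by field_simp

/-- A function with a simply ramified singularity at `1`, continued to a larger slit disk, minus
its polar part grows at most like `(1 - |ζ|) ^ (-1/2)` on the unit disk. -/
theorem exists_growth_sub_polar {g φ₁ φ₂ P : ℂ → ℂ} {r : ℝ} (hr : 0 < r)
    (hg : ContinuousOn g {ζ | ‖ζ‖ ≤ 1 ∧ ζ ≠ 1}) (hP : ContinuousOn P {ζ | ζ ≠ 1})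
    (hφ₁ : ContinuousOn φ₁ (ball (1 : ℂ) r)) (hφ₂ : ContinuousOn φ₂ (ball (1 : ℂ) r))
    (hrep : ∀ ζ ∈ ball (1 : ℂ) r, ‖ζ‖ < 1 →
      g ζ = P ζ + φ₁ ζ * Complex.log (1 - ζ) / (2 * Real.pi * I) + φ₂ ζ) :
    ∃ C : ℝ, 0 ≤ C ∧ ∀ ζ : ℂ, ‖ζ‖ < 1 → ‖g ζ - P ζ‖ ≤ C / √(1 - ‖ζ‖) := by
  have hK : IsCompact (closedBall (0 : ℂ) 1 \ ball 1 (r / 2)) :=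
    (isCompact_closedBall _ _).diff isOpen_ball
  have hK1 : ∀ ζ ∈ closedBall (0 : ℂ) 1 \ ball 1 (r / 2), ζ ≠ 1 := by
    rintro ζ ⟨-, h⟩ rfl
    exact h (mem_ball_self (by linarith))
  obtain ⟨C₀, hC₀⟩ := hK.exists_bound_of_continuousOn
    (f := fun ζ => g ζ - P ζ) ((hg.mono fun ζ hζ => ⟨by simpa using hζ.1, hK1 ζ hζ⟩).sub
      (hP.mono hK1))
  have hsub : closedBall (1 : ℂ) (r / 2) ⊆ ball 1 r := closedBall_subset_ball (by linarith)
  obtain ⟨C₁, hC₁⟩ := (isCompact_closedBall (1 : ℂ) (r / 2)).exists_bound_of_continuousOn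
    (hφ₁.mono hsub)
  obtain ⟨C₂, hC₂⟩ := (isCompact_closedBall (1 : ℂ) (r / 2)).exists_bound_of_continuousOn
    (hφ₂.mono hsub)
  refine ⟨|C₀| + 7 * |C₁| + |C₂|, by positivity, fun ζ hζ => ?_⟩
  have hδ : 0 < 1 - ‖ζ‖ := by linarith
  have hδ1 : 1 - ‖ζ‖ ≤ 1 := by linarith [norm_nonneg ζ]
  have hs : 0 < √(1 - ‖ζ‖) := Real.sqrt_pos.2 hδ
  have hs1 : √(1 - ‖ζ‖) ≤ 1 := Real.sqrt_le_one.2 hδ1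
  by_cases hb : ζ ∈ ball (1 : ℂ) (r / 2)
  · have hlog : ‖Complex.log (1 - ζ)‖ ≤ 7 / √(1 - ‖ζ‖) := by
      refine norm_log_le_div_sqrt hδ hδ1 ?_ ?_
      · simpa using norm_sub_norm_le (1 : ℂ) ζ
      · have := norm_sub_le (1 : ℂ) ζ
        rw [norm_one] at this
        linarith
    have h1 : ‖φ₁ ζ‖ ≤ |C₁| := (hC₁ ζ (ball_subset_closedBall hb)).trans (le_abs_self _)
    have h2 : ‖φ₂ ζ‖ ≤ |C₂| := (hC₂ ζ (ball_subset_closedBall hb)).trans (le_abs_self _)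
    have h3 : ‖φ₁ ζ * Complex.log (1 - ζ) / (2 * Real.pi * I)‖ ≤ |C₁| * (7 / √(1 - ‖ζ‖)) := by
      rw [norm_div, norm_mul]
      refine (div_le_self (by positivity) ?_).trans (by gcongr)
      simp only [norm_mul, Complex.norm_I, Complex.norm_ofNat, Complex.norm_real,
        Real.norm_eq_abs, abs_of_pos Real.pi_pos, mul_one]
      linarith [Real.pi_gt_three]
    have heq : g ζ - P ζ = φ₁ ζ * Complex.log (1 - ζ) / (2 * Real.pi * I) + φ₂ ζ := by
      rw [hrep ζ (ball_subset_ball (by linarith) hb) hζ]; ring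
    have h4 : |C₂| ≤ |C₂| / √(1 - ‖ζ‖) := le_div_self (abs_nonneg _) hs hs1
    rw [heq]
    calc _ ≤ |C₁| * (7 / √(1 - ‖ζ‖)) + |C₂| / √(1 - ‖ζ‖) :=
          (norm_add_le _ _).trans (by linarith)
      _ = (7 * |C₁| + |C₂|) / √(1 - ‖ζ‖) := by ring
      _ ≤ _ := by gcongr; linarith [abs_nonneg C₀]
  · calc ‖g ζ - P ζ‖ ≤ |C₀| :=
          (hC₀ ζ ⟨by simpa using hζ.le, hb⟩).trans (le_abs_self _)
      _ ≤ |C₀| + 7 * |C₁| + |C₂| := by linarith [abs_nonneg C₁, abs_nonneg C₂]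
      _ ≤ _ := le_div_self (by positivity) hs hs1

/-- If `F(ζ) = f₁(ζ)log(1−ζ)/(2πi)` with `f₁` entire and `g` has a simply ramified
singularity at `1` with polar part of order `M`, then `(ζ−1)^M · (F ⊙ g)(ζ) → 0`
as `ζ → 1⁻`. -/
theorem stmt9 (ε r : ℝ) (hε : ε ∈ Set.Ioo (0 : ℝ) 1) (hr : r ∈ Set.Ioo (0 : ℝ) 1)
    (M : ℕ) (hM : 1 ≤ M)
    (f₁ : ℂ → ℂ) (hf₁ : Differentiable ℂ f₁)
    (a : ℕ → ℂ)
    (ha : ∀ ζ : ℂ, ‖ζ‖ < 1 → HasSum (fun n => a n * ζ ^ n)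
      (f₁ ζ * Complex.log (1 - ζ) / (2 * Real.pi * I)))
    (U : Set ℂ) (hU : U = ball (0 : ℂ) (1 + ε) \ (Complex.ofReal '' Set.Ico 1 (1 + ε)))
    (g : ℂ → ℂ) (hg : DifferentiableOn ℂ g U)
    (b : ℕ → ℂ) (hb : ∀ ζ : ℂ, ‖ζ‖ < 1 → HasSum (fun n => b n * ζ ^ n) (g ζ))
    (A : ℕ → ℂ) (hAM : A M ≠ 0) (φ₁ φ₂ : ℂ → ℂ)
    (hφ₁ : DifferentiableOn ℂ φ₁ (ball (1 : ℂ) r))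
    (hφ₂ : DifferentiableOn ℂ φ₂ (ball (1 : ℂ) r))
    (hrep : ∀ ζ ∈ ball (1 : ℂ) r, ζ ∈ U → ζ ∉ Complex.ofReal '' Set.Ici 1 →
      g ζ = (∑ j ∈ Finset.Icc 1 M, A j / (1 - ζ) ^ j) +
        φ₁ ζ * Complex.log (1 - ζ) / (2 * Real.pi * I) + φ₂ ζ) :
    (∀ ζ : ℂ, ‖ζ‖ < 1 → Summable (fun n => a n * b n * ζ ^ n)) ∧
    Tendsto (fun x : ℝ => ((x : ℂ) - 1) ^ M * ∑' n, a n * b n * (x : ℂ) ^ n)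
      (nhdsWithin 1 (Set.Ioo (0 : ℝ) 1)) (nhds 0) := by
  obtain ⟨k, rfl⟩ : ∃ k, M = k + 1 := ⟨M - 1, by omega⟩
  obtain ⟨S, hS, haS⟩ := exists_bound_coeff_entire_mul_log hf₁ ha
  set P : ℂ → ℂ := fun ζ => ∑ j ∈ Finset.Icc 1 (k + 1), A j / (1 - ζ) ^ j with hPdef
  set p : ℕ → ℂ := fun n =>
    ∑ j ∈ Finset.Icc 1 (k + 1), A j * ((n + (j - 1)).choose (j - 1) : ℂ) with hpdef
  have hPsum : ∀ ζ : ℂ, ‖ζ‖ < 1 → HasSum (fun n => p n * ζ ^ n) (P ζ) := by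
    intro ζ hζ
    simp only [hpdef, hPdef, Finset.sum_mul]
    refine hasSum_sum fun j hj => ?_
    have hj1 : j - 1 + 1 = j := Nat.sub_add_cancel (Finset.mem_Icc.1 hj).1
    have := (hasSum_choose_mul_geometric_of_norm_lt_one (j - 1) hζ).mul_left (A j)
    rw [hj1, mul_one_div] at this
    simpa only [mul_assoc] using this
  have hPcont : ContinuousOn P {ζ | ζ ≠ 1} := by
    refine continuousOn_finsetSum _ fun j _ => ContinuousOn.div (by fun_prop) (by fun_prop) ?_
    intro ζ hζ
    exact pow_ne_zero _ (sub_ne_zero.2 (Ne.symm hζ))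
  have hUdisk : ∀ ζ : ℂ, ‖ζ‖ ≤ 1 → ζ ≠ 1 → ζ ∈ U := by
    intro ζ hζ hne
    rw [hU]
    refine ⟨by simpa using by linarith [hε.1], ?_⟩
    rintro ⟨t, ht, rfl⟩
    rw [Complex.norm_real, Real.norm_eq_abs, abs_of_pos (by linarith [ht.1])] at hζ
    exact hne (by rw [le_antisymm hζ ht.1, Complex.ofReal_one])
  obtain ⟨C, hC, hgC⟩ := exists_growth_sub_polar hr.1
    (hg.continuousOn.mono fun ζ hζ => hUdisk ζ hζ.1 hζ.2) hPcont hφ₁.continuousOn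
    hφ₂.continuousOn (fun ζ hζ hζ1 => by
      refine hrep ζ hζ (hUdisk ζ hζ1.le ?_) ?_
      · rintro rfl
        simp at hζ1
      · rintro ⟨t, ht, rfl⟩
        have ht' : 1 ≤ t := ht
        rw [Complex.norm_real, Real.norm_eq_abs, abs_of_pos (by linarith)] at hζ1
        linarith)
  have hbp := norm_coeff_le_sqrt_of_growth (c := fun n => b n - p n) (R := fun ζ => g ζ - P ζ)
    (fun ζ hζ => by simpa only [sub_mul] using (hb ζ hζ).sub (hPsum ζ hζ)) hC hgC
  set Q : ℝ := ∑ j ∈ Finset.Icc 1 (k + 1), ‖A j‖ with hQ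
  have hQ0 : 0 ≤ Q := by positivity
  have hpn : ∀ n, ‖p n‖ ≤ Q * (n + k).choose k := by
    intro n
    rw [hQ, Finset.sum_mul]
    refine norm_sum_le_of_le _ fun j hj => ?_
    rw [norm_mul, Complex.norm_natCast]
    gcongr
    have hj' := (Finset.mem_Icc.1 hj).2
    rw [Nat.choose_symm_add.symm, (Nat.choose_symm_add (a := n) (b := k)).symm]
    exact Nat.choose_le_choose n (by omega)
  refine tendsto_pow_mul_tsum_of_norm_le (u := fun n => a n * b n) (K := S * (Q + 4 * C))
    (by positivity) fun n => ?_
  have hs : 0 < √((n : ℝ) + 1) := by positivity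
  have hs1 : 1 ≤ √((n : ℝ) + 1) := Real.one_le_sqrt.2 (by linarith [Nat.cast_nonneg (α := ℝ) n])
  have hss : √((n : ℝ) + 1) * √((n : ℝ) + 1) = n + 1 := Real.mul_self_sqrt (by positivity)
  have hw : (1 : ℝ) ≤ (n + k).choose k := by
    exact_mod_cast Nat.choose_pos (Nat.le_add_left k n)
  set w : ℝ := (((n + k).choose k : ℕ) : ℝ)
  set s : ℝ := √((n : ℝ) + 1)
  have hbn : ‖b n‖ ≤ (Q + 4 * C) * w * s := by
    calc ‖b n‖ = ‖p n + (b n - p n)‖ := by rw [add_sub_cancel]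
      _ ≤ Q * w + 4 * C * s := (norm_add_le _ _).trans (add_le_add (hpn n) (hbp n))
      _ ≤ Q * w * s + 4 * C * s * w :=
        add_le_add (le_mul_of_one_le_right (by positivity) hs1)
          (le_mul_of_one_le_right (by positivity) hw)
      _ = _ := by ring
  have han : ‖a n‖ ≤ S / (s * s) := by
    rw [hss, le_div_iff₀ (by positivity)]; exact haS n
  calc ‖a n * b n‖ ≤ S / (s * s) * ((Q + 4 * C) * w * s) := by
        rw [norm_mul]; gcongr
    _ = _ := by field_simp
end

section
/- Fix ε, r ∈ (0,1). Let f₁ : ℂ → ℂ be entire and let F(ζ) = f₁(ζ)·log(1−ζ)/(2πi), holomorphic on the unit disk, with Taylor coefficients (a_n)_{n≥0} at 0. Let U = {ζ ∈ ℂ : |ζ| < 1+ε} ∖ [1, 1+ε) and let g : U → ℂ be holomorphic, with Taylor coefficients (b_n)_{n≥0} at 0, and suppose there exist functions g₁, g₂ holomorphic on the disk D(1,r) such that g(ζ) = g₁(ζ)·log(1−ζ)/(2πi) + g₂(ζ) for all ζ ∈ D(1,r) with ζ ∉ [1,∞). Define h₁(ζ) = −(1/(2πi)) ∫_{[1,ζ]}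 f₁(ζ/u) g₁(u) du/u, the integral being taken along the straight segment from 1 to ζ (which avoids 0 since r < 1); then h₁ is holomorphic on D(1,r), and there exist ρ ∈ (0,r) and a function h₂ holomorphic on D(1,ρ) such that, for all real ζ ∈ (1−ρ, 1), Σ_{n≥0} a_n b_n ζ^n = h₁(ζ)·log(1−ζ)/(2πi) + h₂(ζ). -/
open Metric Complex Filter Topology Set MeasureTheory

theorem differentiableOn_intervalIntegral_param {V : Set ℂ} (hV : IsOpen V) {a b : ℝ}
    (hab : a ≤ b) {F : ℂ → ℝ → ℂ}
    (hc : ContinuousOn (Function.uncurry F) (V ×ˢ Icc a b))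
    (hd : ∀ t ∈ Icc a b, DifferentiableOn ℂ (fun z => F z t) V) :
    DifferentiableOn ℂ (fun z => ∫ t in a..b, F z t) V := by
  intro z₀ hz₀
  have hct : ∀ z ∈ V, ContinuousOn (F z) (Icc a b) := fun z hz =>
    hc.comp (f := fun t : ℝ => (z, t)) (by fun_prop) fun t ht => ⟨hz, ht⟩
  have hsub : uIoc a b ⊆ Icc a b := by rw [uIoc_of_le hab]; exact Ioc_subset_Icc_self
  have hmeas : ∀ z ∈ V, AEStronglyMeasurable (F z) (volume.restrict (uIoc a b)) := fun z hz =>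
    ((hct z hz).mono hsub).aestronglyMeasurable measurableSet_uIoc
  obtain ⟨δ, hδ, hδV⟩ := nhds_basis_closedBall.mem_iff.1 (hV.mem_nhds hz₀)
  obtain ⟨M, hM⟩ := ((isCompact_closedBall z₀ δ).prod isCompact_Icc).exists_bound_of_continuousOn
    (hc.mono (prod_mono hδV (Subset.refl _)))
  have hball : ∀ z ∈ ball z₀ (δ / 2), closedBall z (δ / 2) ⊆ closedBall z₀ δ := fun z hz =>
    closedBall_subset_closedBall' (by linarith [mem_ball.1 hz])
  have hballV : ∀ z ∈ ball z₀ (δ / 2), z ∈ V := fun z hz =>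
    hδV (hball z hz (mem_closedBall_self (by positivity)))
  have hderiv : ∀ t ∈ Icc a b, ∀ z ∈ V, HasDerivAt (fun z => F z t) (deriv (fun z => F z t) z) z :=
    fun t ht z hz => ((hd t ht).differentiableAt (hV.mem_nhds hz)).hasDerivAt
  have key := intervalIntegral.hasDerivAt_integral_of_dominated_loc_of_deriv_le
    (𝕜 := ℂ) (μ := volume) (a := a) (b := b) (F := F) (x₀ := z₀)
    (F' := fun z t => deriv (fun z => F z t) z) (bound := fun _ => M / (δ / 2))
    (ball_mem_nhds z₀ (half_pos hδ))
    (by filter_upwards [hV.mem_nhds hz₀] with z hz using hmeas z hz)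
    ((hct z₀ hz₀).intervalIntegrable_of_Icc hab)
    ?_ ?_ intervalIntegrable_const ?_
  · exact key.2.differentiableAt.differentiableWithinAt
  · have hlim : Tendsto (fun n : ℕ => ((δ / 2 / (n + 1) : ℝ) : ℂ)) atTop (𝓝[≠] 0) := by
      rw [tendsto_nhdsWithin_iff]
      constructor
      · have : Tendsto (fun n : ℕ => (δ / 2 / (n + 1) : ℝ)) atTop (𝓝 0) := by
          simpa [div_eq_mul_inv] using
            (tendsto_one_div_add_atTop_nhds_zero_nat (𝕜 := ℝ)).const_mul (δ / 2)
        exact_mod_cast (continuous_ofReal.tendsto 0).comp this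
      · filter_upwards with n
        simp only [mem_compl_iff, mem_singleton_iff, ofReal_eq_zero]
        positivity
    refine aestronglyMeasurable_of_tendsto_ae (f := fun (n : ℕ) t =>
      ((δ / 2 / (n + 1) : ℝ) : ℂ)⁻¹ • (F (z₀ + ((δ / 2 / (n + 1) : ℝ) : ℂ)) t - F z₀ t)) atTop ?_ ?_
    · intro n
      refine AEStronglyMeasurable.const_smul ((hmeas _ (hδV ?_)).sub (hmeas _ hz₀))
        (((δ / 2 / (n + 1) : ℝ) : ℂ)⁻¹)
      rw [mem_closedBall, dist_self_add_left, norm_real, Real.norm_of_nonneg (by positivity)]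
      rw [div_le_iff₀ (by positivity)]
      have : (0:ℝ) ≤ n := n.cast_nonneg
      nlinarith
    · filter_upwards [ae_restrict_mem measurableSet_uIoc] with t ht
      exact (hasDerivAt_iff_tendsto_slope_zero.1 (hderiv t (hsub ht) z₀ hz₀)).comp hlim
  · filter_upwards with t ht z hz
    refine Complex.norm_deriv_le_of_forall_mem_sphere_norm_le (by positivity) ?_ fun w hw =>
      hM (w, t) ⟨hball z hz (sphere_subset_closedBall hw), hsub ht⟩
    refine DifferentiableOn.diffContOnCl ((hd t (hsub ht)).mono ?_)
    exact closure_ball_subset_closedBall.trans ((hball z hz).trans hδV)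
  · filter_upwards with t ht z hz using hderiv t (hsub ht) z (hballV z hz)

theorem continuousOn_intervalIntegral_param {X : Type*} [TopologicalSpace X] {S : Set X}
    {a b : ℝ} (hab : a ≤ b) {F : X → ℝ → ℂ} (hc : ContinuousOn (Function.uncurry F) (S ×ˢ Icc a b)) :
    ContinuousOn (fun x => ∫ t in a..b, F x t) S := by
  rw [continuousOn_iff_continuous_domRestrict]
  have h : Continuous (fun x : S => ∫ t in a..b, F x (projIcc a b hab t)) := by
    refine intervalIntegral.continuous_parametric_intervalIntegral_of_continuous' ?_ a b
    exact hc.comp_continuous (f := fun p : S × ℝ => ((p.1 : X), (projIcc a b hab p.2 : ℝ)))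
      (by fun_prop) fun p => ⟨p.1.2, (projIcc a b hab p.2).2⟩
  refine h.congr fun x => intervalIntegral.integral_congr fun t ht => ?_
  rw [uIcc_of_le hab] at ht
  simp only [projIcc_of_mem hab ht]

theorem eq_of_hasSum_pow_eq {a a' : ℕ → ℂ} {f : ℂ → ℂ}
    (h : ∀ z : ℂ, ‖z‖ < 1 → HasSum (fun n => a n * z ^ n) (f z))
    (h' : ∀ z : ℂ, ‖z‖ < 1 → HasSum (fun n => a' n * z ^ n) (f z)) : a = a' := by
  have key : ∀ c : ℕ → ℂ, (∀ z : ℂ, ‖z‖ < 1 → HasSum (fun n => c n * z ^ n) (f z)) →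
      HasFPowerSeriesAt f (FormalMultilinearSeries.ofScalars ℂ c) 0 := by
    intro c hc
    rw [hasFPowerSeriesAt_iff]
    filter_upwards [ball_mem_nhds (0 : ℂ) one_pos] with z hz
    simpa [mul_comm] using hc z (by simpa using hz)
  have := (key a h).eq_formalMultilinearSeries (key a' h')
  funext n
  simpa using congrArg (fun p => FormalMultilinearSeries.coeff p n) this

theorem hasSum_cauchyProduct_log {c : ℕ → ℂ} {f : ℂ → ℂ}
    (hc : ∀ z, HasSum (fun k => c k * z ^ k) (f z)) {z : ℂ} (hz : ‖z‖ < 1) :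
    HasSum (fun n => (∑ k ∈ Finset.range (n + 1), c k / ((n - k : ℕ) : ℂ)) * z ^ n)
      (-(f z * log (1 - z))) := by
  have hl := hasSum_taylorSeries_neg_log hz
  have h1 := (hc z).summable.norm
  have h2 := hl.summable.norm
  have h3 := (summable_norm_sum_mul_antidiagonal_of_summable_norm h1 h2).of_norm.hasSum
  rw [← tsum_mul_tsum_eq_tsum_sum_antidiagonal_of_summable_norm h1 h2, (hc z).tsum_eq,
    hl.tsum_eq, mul_neg] at h3
  refine h3.congr_fun fun n => ?_
  rw [Finset.Nat.sum_antidiagonal_eq_sum_range_succ (fun k l => c k * z ^ k * (z ^ l / (l : ℂ))),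
    Finset.sum_mul]
  refine Finset.sum_congr rfl fun k hk => ?_
  rw [← Nat.add_sub_of_le (Finset.mem_range_succ_iff.1 hk), pow_add, Nat.add_sub_cancel_left]
  ring

theorem norm_inv_sub_integral_le {R : ℝ} (h1 : 1 < R) (h2 : R ≤ 2) (n k : ℕ) :
    ‖1 / ((n - k : ℕ) : ℂ) - ∫ w in (1 : ℝ)..R, (w : ℂ) ^ k / (w : ℂ) ^ (n + 1)‖
      ≤ R ^ k / R ^ n := by
  have hR : 0 < R := by linarith
  have hint : ∫ w in (1 : ℝ)..R, (w : ℂ) ^ k / (w : ℂ) ^ (n + 1) =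
      ((∫ w in (1 : ℝ)..R, w ^ k / w ^ (n + 1) : ℝ) : ℂ) := by
    rw [← intervalIntegral.integral_ofReal]
    push_cast
    rfl
  have hcast : 1 / ((n - k : ℕ) : ℂ) = ((1 / ((n - k : ℕ) : ℝ) : ℝ) : ℂ) := by push_cast; rfl
  rw [hint, hcast, ← ofReal_sub, norm_real]
  rcases lt_or_ge k n with hkn | hkn
  · obtain ⟨m, rfl⟩ := Nat.exists_eq_add_of_lt hkn
    have h0 : (0 : ℝ) ∉ uIcc 1 R := by
      rw [uIcc_of_le h1.le]; exact fun h => by linarith [h.1]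
    have hcongr : ∫ w in (1 : ℝ)..R, w ^ k / w ^ (k + m + 1 + 1) =
        ∫ w in (1 : ℝ)..R, w ^ (-((m : ℤ) + 2)) := by
      refine intervalIntegral.integral_congr fun w hw => ?_
      have hw0 : w ≠ 0 := fun h => h0 (h ▸ hw)
      have : w ^ (-((m : ℤ) + 2)) = (w ^ (m + 2))⁻¹ := by
        rw [zpow_neg]; norm_cast
      simp only [this]
      field_simp
      ring
    rw [hcongr, integral_zpow (Or.inr ⟨by omega, h0⟩), show k + m + 1 - k = m + 1 by omega]
    have hz : R ^ (-((m : ℤ) + 2) + 1) = (R ^ (m + 1))⁻¹ := by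
      rw [show -((m : ℤ) + 2) + 1 = -((m + 1 : ℕ) : ℤ) by push_cast; ring, zpow_neg, zpow_natCast]
    have hm : (0 : ℝ) < m + 1 := by positivity
    have : 1 / ((m + 1 : ℕ) : ℝ) - (R ^ (-((m : ℤ) + 2) + 1) - 1 ^ (-((m : ℤ) + 2) + 1)) /
        (((-((m : ℤ) + 2) : ℤ) : ℝ) + 1) = (R ^ (m + 1))⁻¹ / (m + 1) := by
      rw [hz, one_zpow]
      push_cast
      rw [show -((m : ℝ) + 2) + 1 = -(m + 1) by ring]
      field_simp
      ring
    rw [this, Real.norm_of_nonneg (by positivity), add_assoc, pow_add R k,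
      div_mul_cancel_left₀ (by positivity)]
    exact div_le_self (by positivity) (by linarith [(Nat.cast_nonneg m : (0 : ℝ) ≤ m)])
  · rw [Nat.sub_eq_zero_of_le hkn, Nat.cast_zero, div_zero, zero_sub, norm_neg]
    refine (intervalIntegral.norm_integral_le_of_norm_le_const (C := R ^ k / R ^ n) ?_).trans ?_
    · intro w hw
      rw [uIoc_of_le h1.le] at hw
      have hw0 : 0 < w := by linarith [hw.1]
      rw [Real.norm_of_nonneg (by positivity)]
      obtain ⟨m, rfl⟩ := Nat.exists_eq_add_of_le hkn
      rw [pow_add w, pow_add R, mul_div_cancel_left₀ _ (by positivity), pow_succ,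
        mul_div_mul_left _ _ (by positivity)]
      exact (div_le_self (by positivity) hw.1.le).trans (by gcongr; exact hw.2)
    · rw [abs_of_pos (by linarith)]
      exact mul_le_of_le_one_right (by positivity) (by linarith)

theorem exists_norm_sub_integral_le {f : ℂ → ℂ} (hf : Differentiable ℂ f) {A : ℕ → ℂ}
    (hA : ∀ z : ℂ, ‖z‖ < 1 → HasSum (fun n => A n * z ^ n) (-(f z * log (1 - z))))
    {R : ℝ} (h1 : 1 < R) (h2 : R ≤ 2) :
    ∃ C : ℝ, ∀ n, ‖A n - ∫ w in (1 : ℝ)..R, f w / (w : ℂ) ^ (n + 1)‖ ≤ C / R ^ n := by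
  have hR : 0 < R := by linarith
  obtain ⟨c, hc⟩ : ∃ c : ℕ → ℂ, ∀ z, HasSum (fun k => c k * z ^ k) (f z) := by
    refine ⟨fun k => (k.factorial : ℂ)⁻¹ * iteratedDeriv k f 0, fun z => ?_⟩
    refine (hasSum_taylorSeries_of_entire hf 0 z).congr_fun fun k => ?_
    simp only [sub_zero, smul_eq_mul]
    ring
  have hAc := eq_of_hasSum_pow_eq hA fun z hz => hasSum_cauchyProduct_log hc hz
  have hcR : Summable fun k => ‖c k‖ * R ^ k := by
    convert (hc R).summable.norm using 2 with k
    rw [norm_mul, norm_pow, norm_real, Real.norm_of_nonneg hR.le]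
  refine ⟨∑' k, ‖c k‖ * R ^ k, fun n => ?_⟩
  have hsum : HasSum (fun k => c k / ((n - k : ℕ) : ℂ)) (A n) := by
    rw [hAc]
    refine hasSum_sum_of_ne_finset_zero fun k hk => ?_
    rw [Finset.mem_range, not_lt] at hk
    rw [Nat.sub_eq_zero_of_le (by omega), Nat.cast_zero, div_zero]
  have hint : HasSum (fun k => ∫ w in (1 : ℝ)..R, c k * (w : ℂ) ^ k / (w : ℂ) ^ (n + 1))
      (∫ w in (1 : ℝ)..R, f w / (w : ℂ) ^ (n + 1)) := by
    refine intervalIntegral.hasSum_integral_of_dominated_convergence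
      (fun k _ => ‖c k‖ * R ^ k) ?_ ?_ ?_ intervalIntegrable_const ?_
    · intro k
      exact Measurable.aestronglyMeasurable (by fun_prop)
    · intro k
      filter_upwards with w hw
      rw [uIoc_of_le h1.le] at hw
      have hw0 : 0 < w := by linarith [hw.1]
      rw [norm_div, norm_mul, norm_pow, norm_pow, norm_real, Real.norm_of_nonneg hw0.le]
      refine (div_le_self (by positivity) (one_le_pow₀ hw.1.le)).trans ?_
      gcongr
      exact hw.2
    · filter_upwards with w _ using hcR
    · filter_upwards with w _ using (hc w).div_const _
  rw [← (hsum.sub hint).tsum_eq, ← tsum_div_const]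
  refine tsum_of_norm_bounded (hcR.div_const _).hasSum fun k => ?_
  have : ∀ w : ℝ, c k * (w : ℂ) ^ k / (w : ℂ) ^ (n + 1) =
    c k * ((w : ℂ) ^ k / (w : ℂ) ^ (n + 1)) := fun w => mul_div_assoc _ _ _
  simp_rw [this]
  rw [intervalIntegral.integral_const_mul, ← mul_one_div (c k), ← mul_sub, norm_mul, mul_div_assoc]
  gcongr
  exact norm_inv_sub_integral_le h1 h2 n k

theorem one_add_mul_sub_one_mem_ball {r : ℝ} {u : ℂ} (hu : u ∈ ball (1 : ℂ) r) {t : ℝ}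
    (ht : t ∈ Icc (0 : ℝ) 1) : 1 + (t : ℂ) * (u - 1) ∈ ball (1 : ℂ) r := by
  rw [mem_ball, dist_eq] at hu ⊢
  rw [add_sub_cancel_left, norm_mul, norm_real, Real.norm_of_nonneg ht.1]
  exact (mul_le_of_le_one_left (norm_nonneg _) ht.2).trans_lt hu

theorem ne_zero_of_mem_ball_one {r : ℝ} (hr : r < 1) {u : ℂ} (hu : u ∈ ball (1 : ℂ) r) :
    u ≠ 0 := by
  rintro rfl
  rw [mem_ball, dist_eq, zero_sub, norm_neg, norm_one] at hu
  linarith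

/-- The mean of `u ↦ f (ζ / u) g u / u` over the segment from `1` to `u`. -/
noncomputable def segmentMean (f g : ℂ → ℂ) (ζ u : ℂ) : ℂ :=
  ∫ t in (0 : ℝ)..1, f (ζ / (1 + (t : ℂ) * (u - 1))) * g (1 + (t : ℂ) * (u - 1)) /
    (1 + (t : ℂ) * (u - 1))

section SegmentMean

variable {r : ℝ} {f g : ℂ → ℂ}

theorem continuousOn_segmentMean (hr : r < 1) (hf : Continuous f)
    (hg : ContinuousOn g (ball 1 r)) :
    ContinuousOn (fun p : ℂ × ℂ => segmentMean f g p.1 p.2) (univ ×ˢ ball (1 : ℂ) r) := by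
  refine continuousOn_intervalIntegral_param zero_le_one ?_
  have hmaps : ∀ q ∈ ((univ : Set ℂ) ×ˢ ball (1 : ℂ) r) ×ˢ Icc (0 : ℝ) 1,
      1 + (q.2 : ℂ) * (q.1.2 - 1) ∈ ball (1 : ℂ) r :=
    fun q hq => one_add_mul_sub_one_mem_ball hq.1.2 hq.2
  have hne := fun q hq => ne_zero_of_mem_ball_one hr (hmaps q hq)
  have hv : ContinuousOn (fun q : (ℂ × ℂ) × ℝ => 1 + (q.2 : ℂ) * (q.1.2 - 1))
      ((univ ×ˢ ball (1 : ℂ) r) ×ˢ Icc (0 : ℝ) 1) := by fun_prop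
  exact ((hf.comp_continuousOn ((by fun_prop : Continuous fun q : (ℂ × ℂ) × ℝ =>
    q.1.1).continuousOn.div hv hne)).mul (hg.comp hv hmaps)).div hv hne

theorem differentiableOn_segmentMean (hr : r < 1) (hf : Differentiable ℂ f)
    (hg : DifferentiableOn ℂ g (ball 1 r)) {V : Set ℂ} (hV : IsOpen V) {φ : ℂ → ℂ}
    (hφ : DifferentiableOn ℂ φ V) (hmaps : MapsTo φ V (ball 1 r)) :
    DifferentiableOn ℂ (fun ζ => segmentMean f g ζ (φ ζ)) V := by
  refine differentiableOn_intervalIntegral_param hV zero_le_one ?_ fun t ht => ?_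
  · have hm : ∀ q ∈ V ×ˢ Icc (0 : ℝ) 1, 1 + (q.2 : ℂ) * (φ q.1 - 1) ∈ ball (1 : ℂ) r :=
      fun q hq => one_add_mul_sub_one_mem_ball (hmaps hq.1) hq.2
    have hne := fun q hq => ne_zero_of_mem_ball_one hr (hm q hq)
    have hφ' : ContinuousOn (fun q : ℂ × ℝ => φ q.1) (V ×ˢ Icc (0 : ℝ) 1) :=
      hφ.continuousOn.comp continuousOn_fst fun q hq => hq.1
    have hv : ContinuousOn (fun q : ℂ × ℝ => 1 + (q.2 : ℂ) * (φ q.1 - 1))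
        (V ×ˢ Icc (0 : ℝ) 1) :=
      continuousOn_const.add ((continuous_ofReal.comp continuous_snd).continuousOn.mul
        (hφ'.sub continuousOn_const))
    exact ((hf.continuous.comp_continuousOn (continuousOn_fst.div hv hne)).mul
      (hg.continuousOn.comp hv hm)).div hv hne
  · have hm : ∀ z ∈ V, 1 + (t : ℂ) * (φ z - 1) ∈ ball (1 : ℂ) r :=
      fun z hz => one_add_mul_sub_one_mem_ball (hmaps hz) ht
    have hne := fun z hz => ne_zero_of_mem_ball_one hr (hm z hz)
    have hv : DifferentiableOn ℂ (fun z => 1 + (t : ℂ) * (φ z - 1)) V := by fun_prop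
    exact ((hf.comp_differentiableOn (differentiableOn_id.div hv hne)).mul
      (hg.comp hv hm)).div hv hne

theorem hasDerivAt_sub_one_mul_segmentMean (hr : r < 1) (hf : Differentiable ℂ f)
    (hg : DifferentiableOn ℂ g (ball 1 r)) (ζ : ℂ) {u : ℂ} (hu : u ∈ ball (1 : ℂ) r) :
    HasDerivAt (fun u => (u - 1) * segmentMean f g ζ u) (f (ζ / u) * g u / u) u := by
  have hk : DifferentiableOn ℂ (fun u => f (ζ / u) * g u / u) (ball 1 r) := by
    have hne : ∀ z ∈ ball (1 : ℂ) r, z ≠ 0 := fun z hz => ne_zero_of_mem_ball_one hr hz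
    exact ((hf.comp_differentiableOn ((differentiableOn_const ζ).div differentiableOn_id hne)).mul
      hg).div differentiableOn_id hne
  obtain ⟨P, hP⟩ := hk.isExactOn_ball
  have key : ∀ v ∈ ball (1 : ℂ) r, (v - 1) * segmentMean f g ζ v = P v - P 1 := by
    intro v hv
    have hderiv : ∀ t ∈ uIcc (0 : ℝ) 1, HasDerivAt (fun t : ℝ => P (1 + (t : ℂ) * (v - 1)))
        (f (ζ / (1 + (t : ℂ) * (v - 1))) * g (1 + (t : ℂ) * (v - 1)) /
          (1 + (t : ℂ) * (v - 1)) * (v - 1)) t := by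
      intro t ht
      rw [uIcc_of_le zero_le_one] at ht
      have h1 : HasDerivAt (fun z : ℂ => 1 + z * (v - 1)) (v - 1) (t : ℂ) := by
        simpa using ((hasDerivAt_id (t : ℂ)).mul_const (v - 1)).const_add 1
      exact ((hP _ (one_add_mul_sub_one_mem_ball hv ht)).comp (t : ℂ) h1).comp_ofReal
    have hcont : ContinuousOn (fun t : ℝ => f (ζ / (1 + (t : ℂ) * (v - 1))) *
        g (1 + (t : ℂ) * (v - 1)) / (1 + (t : ℂ) * (v - 1)) * (v - 1)) (Icc 0 1) :=
      (hk.continuousOn.comp (f := fun t : ℝ => 1 + (t : ℂ) * (v - 1)) (by fun_prop)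
        fun t ht => one_add_mul_sub_one_mem_ball hv ht).mul continuousOn_const
    have := intervalIntegral.integral_eq_sub_of_hasDerivAt hderiv
      (hcont.intervalIntegrable_of_Icc zero_le_one)
    rw [intervalIntegral.integral_mul_const] at this
    rw [mul_comm, segmentMean, this]
    simp
  refine ((hP u hu).sub_const (P 1)).congr_of_eventuallyEq ?_
  filter_upwards [isOpen_ball.mem_nhds hu] with v hv using key v hv

/-- Integration by parts against the logarithm. -/
theorem integral_mul_log_eq (hr : r < 1) (hf : Differentiable ℂ f)
    (hg : DifferentiableOn ℂ g (ball 1 r)) {x R : ℝ} (hx0 : 0 < x) (hx1 : x < 1) (hR : 1 ≤ R)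
    (hmem : ∀ w ∈ Icc 1 R, (x / w : ℂ) ∈ ball (1 : ℂ) r) :
    ∫ w in (1 : ℝ)..R, f w * (g (x / w) * log (1 - x / w)) / w =
      (x - 1) * segmentMean f g x x * log (1 - x) -
      (x / R - 1) * segmentMean f g x (x / R) * log (1 - x / R) -
      ∫ w in (1 : ℝ)..R, segmentMean f g x (x / w) * (x / w ^ 2) := by
  have hpos : ∀ w ∈ Icc 1 R, 0 < w := fun w hw => by linarith [hw.1]
  have hne : ∀ w ∈ Icc 1 R, (w : ℂ) ≠ 0 := fun w hw => ofReal_ne_zero.2 (hpos w hw).ne'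
  have hslit : ∀ w ∈ Icc 1 R, (1 - x / w : ℂ) ∈ slitPlane := by
    intro w hw
    have : (1 - x / w : ℂ) = ((1 - x / w : ℝ) : ℂ) := by push_cast; rfl
    rw [this, ofReal_mem_slitPlane, sub_pos, div_lt_one (hpos w hw)]
    linarith [hw.1]
  have hu : ContinuousOn (fun w : ℝ => (x / w : ℂ)) (Icc 1 R) :=
    continuousOn_const.div (by fun_prop) hne
  have hQ : ContinuousOn (fun w : ℝ => segmentMean f g x (x / w)) (Icc 1 R) :=
    (continuousOn_segmentMean hr hf.continuous hg.continuousOn).comp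
      (f := fun w : ℝ => ((x : ℂ), (x / w : ℂ))) (continuousOn_const.prodMk hu)
      fun w hw => ⟨mem_univ _, hmem w hw⟩
  have hI1 : ContinuousOn (fun w : ℝ => f w * (g (x / w) * log (1 - x / w)) / w) (Icc 1 R) :=
    ((hf.continuous.comp continuous_ofReal).continuousOn.mul
      ((hg.continuousOn.comp hu hmem).mul ((continuousOn_const.sub hu).clog hslit))).div
      (by fun_prop) hne
  have hI2 : ContinuousOn (fun w : ℝ => segmentMean f g x (x / w) * (x / w ^ 2)) (Icc 1 R) :=
    hQ.mul (continuousOn_const.div (by fun_prop) fun w hw => pow_ne_zero 2 (hne w hw))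
  rw [eq_sub_iff_add_eq, ← intervalIntegral.integral_add (hI1.intervalIntegrable_of_Icc hR)
    (hI2.intervalIntegrable_of_Icc hR)]
  have hderiv : ∀ w ∈ uIcc 1 R, HasDerivAt
      (fun w : ℝ => -((x / w - 1) * segmentMean f g x (x / w) * log (1 - x / w)))
      (f w * (g (x / w) * log (1 - x / w)) / w + segmentMean f g x (x / w) * (x / w ^ 2)) w := by
    intro w hw
    rw [uIcc_of_le hR] at hw
    have h1 : HasDerivAt (fun z : ℂ => x / z) (-(x / (w : ℂ) ^ 2)) w := by
      simpa [div_eq_mul_inv] using (hasDerivAt_inv (hne w hw)).const_mul (x : ℂ)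
    have h2 := (hasDerivAt_sub_one_mul_segmentMean hr hf hg x (hmem w hw)).mul
      (((hasDerivAt_id (x / w : ℂ)).const_sub 1).clog (hslit w hw))
    have h3 := (h2.comp (w : ℂ) h1).neg.comp_ofReal
    refine h3.congr_deriv ?_
    have hw0 := hne w hw
    have hx : (x : ℂ) ≠ 0 := ofReal_ne_zero.2 hx0.ne'
    have hl : (1 - x / w : ℂ) ≠ 0 := slitPlane_ne_zero (hslit w hw)
    have e1 : (x / (x / w) : ℂ) = w := by field_simp
    have e2 : ((x / w : ℂ) - 1) * segmentMean f g x (x / w) * (-1 / (1 - x / w)) =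
        segmentMean f g x (x / w) := by
      rw [show (x / w : ℂ) - 1 = -(1 - x / w) by ring]
      generalize (1 - x / w : ℂ) = l at hl
      field_simp
    simp only [id, e1, e2]
    field_simp
  rw [intervalIntegral.integral_eq_sub_of_hasDerivAt hderiv
    ((hI1.add hI2).intervalIntegrable_of_Icc hR)]
  simp only [ofReal_one, div_one]
  ring

end SegmentMean

theorem div_mem_ball_one {r : ℝ} (hr0 : 0 < r) {ζ : ℂ} (hζ : ζ ∈ ball (1 : ℂ) (r / 4))
    {w : ℝ} (hw : w ∈ Icc 1 (1 + r / 2)) : ζ / w ∈ ball (1 : ℂ) r := by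
  have hw0 : 0 < w := by linarith [hw.1]
  have hwc : (w : ℂ) ≠ 0 := ofReal_ne_zero.2 hw0.ne'
  rw [mem_ball, dist_eq] at hζ ⊢
  rw [show ζ / w - 1 = (ζ - w) / w by field_simp, norm_div, norm_real,
    Real.norm_of_nonneg hw0.le, div_lt_iff₀ hw0]
  have h1 : ‖ζ - w‖ ≤ ‖ζ - 1‖ + (w - 1) := by
    have h2 : ‖((1 - w : ℝ) : ℂ)‖ = w - 1 := by
      rw [norm_real, Real.norm_of_nonpos (by linarith [hw.1])]; ring
    calc ‖ζ - w‖ = ‖(ζ - 1) + ((1 - w : ℝ) : ℂ)‖ := by push_cast; ring_nf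
      _ ≤ _ := (norm_add_le _ _).trans_eq (by rw [h2])
  nlinarith [hw.1, hw.2]

/-- A Hadamard product whose first factor is bounded by `C / R ^ n` is holomorphic beyond the
unit disk. -/
theorem summable_and_differentiableOn_tsum {e b : ℕ → ℂ} {C R s : ℝ} (hR : 0 < R)
    (he : ∀ n, ‖e n‖ ≤ C / R ^ n) (hb : Summable fun n => ‖b n‖ * s ^ n)
    {V : Set ℂ} (hV : IsOpen V) (hVs : ∀ z ∈ V, ‖z‖ ≤ s * R) :
    (∀ z ∈ V, Summable fun n => e n * b n * z ^ n) ∧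
      DifferentiableOn ℂ (fun z => ∑' n, e n * b n * z ^ n) V := by
  have hbound : ∀ n, ∀ z ∈ V, ‖e n * b n * z ^ n‖ ≤ C * (‖b n‖ * s ^ n) := by
    intro n z hz
    rw [norm_mul, norm_mul, norm_pow]
    calc ‖e n‖ * ‖b n‖ * ‖z‖ ^ n ≤ C / R ^ n * ‖b n‖ * (s * R) ^ n := by
          have := he n
          have := hVs z hz
          have : 0 ≤ C / R ^ n := (norm_nonneg _).trans (he n)
          gcongr
      _ = C * (‖b n‖ * s ^ n) := by
          rw [mul_pow]; field_simp
  exact ⟨fun z hz => .of_norm_bounded (hb.mul_left C) fun n => hbound n z hz,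
    differentiableOn_tsum_of_summable_norm (hb.mul_left C) (fun n => by fun_prop) hV hbound⟩

theorem hasSum_mul_integral {f g : ℂ → ℂ} (hf : Continuous f) {b : ℕ → ℂ}
    (hb : ∀ z : ℂ, ‖z‖ < 1 → HasSum (fun n => b n * z ^ n) (g z)) {R x : ℝ} (hR : 1 ≤ R)
    (hx0 : 0 < x) (hx1 : x < 1) :
    HasSum (fun n => (∫ w in (1 : ℝ)..R, f w / (w : ℂ) ^ (n + 1)) * b n * (x : ℂ) ^ n)
      (∫ w in (1 : ℝ)..R, f w * g (x / w) / w) := by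
  obtain ⟨M, hM⟩ := isCompact_Icc.exists_bound_of_continuousOn
    (hf.comp continuous_ofReal).continuousOn (s := Icc 1 R)
  have hbx : Summable fun n => ‖b n‖ * x ^ n := by
    convert (hb x (by rwa [norm_real, Real.norm_of_nonneg hx0.le])).summable.norm using 2 with n
    rw [norm_mul, norm_pow, norm_real, Real.norm_of_nonneg hx0.le]
  have key : HasSum (fun n => ∫ w in (1 : ℝ)..R, f w / (w : ℂ) ^ (n + 1) * (b n * (x : ℂ) ^ n))
      (∫ w in (1 : ℝ)..R, f w * g (x / w) / w) := by
    refine intervalIntegral.hasSum_integral_of_dominated_convergence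
      (fun n _ => M * (‖b n‖ * x ^ n)) ?_ ?_ ?_ intervalIntegrable_const ?_
    · intro n
      have := hf.measurable
      exact Measurable.aestronglyMeasurable (by fun_prop)
    · intro n
      filter_upwards with w hw
      rw [uIoc_of_le hR] at hw
      have hw0 : 0 < w := by linarith [hw.1]
      rw [norm_mul, norm_div, norm_mul, norm_pow, norm_pow, norm_real, norm_real,
        Real.norm_of_nonneg hw0.le, Real.norm_of_nonneg hx0.le]
      gcongr
      exact (div_le_self (norm_nonneg _) (one_le_pow₀ hw.1.le)).trans (hM w ⟨hw.1.le, hw.2⟩)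
    · filter_upwards with w _ using hbx.mul_left M
    · filter_upwards with w hw
      rw [uIoc_of_le hR] at hw
      have hw0 : 0 < w := by linarith [hw.1]
      have hwc : (w : ℂ) ≠ 0 := ofReal_ne_zero.2 hw0.ne'
      have hlt : ‖(x / w : ℂ)‖ < 1 := by
        rw [norm_div, norm_real, norm_real, Real.norm_of_nonneg hw0.le,
          Real.norm_of_nonneg hx0.le, div_lt_one hw0]
        linarith [hw.1]
      rw [mul_div_right_comm]
      refine ((hb _ hlt).mul_left (f w / w)).congr_fun fun n => ?_
      rw [div_pow, pow_succ]
      field_simp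
  refine key.congr_fun fun n => ?_
  rw [intervalIntegral.integral_mul_const, mul_assoc]

/-- Monodromy formula for the Hadamard product: if `F(ζ) = f₁(ζ)log(1−ζ)/(2πi)` with `f₁`
entire and `g` has a logarithmic singularity `g₁(ζ)log(1−ζ)/(2πi) + g₂(ζ)` at `1`, then
near `1` the Hadamard product equals `h₁(ζ)log(1−ζ)/(2πi) + h₂(ζ)` where
`h₁(ζ) = −(1/2πi)∫_{[1,ζ]} f₁(ζ/u) g₁(u) du/u` (segment parametrized by `u = 1+t(ζ−1)`). -/
theorem stmt10 (ε r : ℝ) (hε : ε ∈ Set.Ioo (0 : ℝ) 1) (hr : r ∈ Set.Ioo (0 : ℝ) 1)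
    (f₁ : ℂ → ℂ) (hf₁ : Differentiable ℂ f₁)
    (a : ℕ → ℂ)
    (ha : ∀ ζ : ℂ, ‖ζ‖ < 1 → HasSum (fun n => a n * ζ ^ n)
      (f₁ ζ * Complex.log (1 - ζ) / (2 * Real.pi * I)))
    (U : Set ℂ) (hU : U = ball (0 : ℂ) (1 + ε) \ (Complex.ofReal '' Set.Ico 1 (1 + ε)))
    (g : ℂ → ℂ) (hg : DifferentiableOn ℂ g U)
    (b : ℕ → ℂ) (hb : ∀ ζ : ℂ, ‖ζ‖ < 1 → HasSum (fun n => b n * ζ ^ n) (g ζ))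
    (g₁ g₂ : ℂ → ℂ)
    (hg₁ : DifferentiableOn ℂ g₁ (ball (1 : ℂ) r))
    (hg₂ : DifferentiableOn ℂ g₂ (ball (1 : ℂ) r))
    (hrep : ∀ ζ ∈ ball (1 : ℂ) r, ζ ∈ U → ζ ∉ Complex.ofReal '' Set.Ici 1 →
      g ζ = g₁ ζ * Complex.log (1 - ζ) / (2 * Real.pi * I) + g₂ ζ)
    (h₁ : ℂ → ℂ)
    (hh₁ : ∀ ζ ∈ ball (1 : ℂ) r, h₁ ζ = -(1 / (2 * Real.pi * I)) * ((ζ - 1) *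
      ∫ t in (0:ℝ)..1, f₁ (ζ / (1 + (t : ℂ) * (ζ - 1))) * g₁ (1 + (t : ℂ) * (ζ - 1)) /
        (1 + (t : ℂ) * (ζ - 1)))) :
    DifferentiableOn ℂ h₁ (ball (1 : ℂ) r) ∧
    ∃ ρ : ℝ, 0 < ρ ∧ ρ < r ∧ ∃ h₂ : ℂ → ℂ, DifferentiableOn ℂ h₂ (ball (1 : ℂ) ρ) ∧
      ∀ x : ℝ, 1 - ρ < x → x < 1 →
        HasSum (fun n => a n * b n * (x : ℂ) ^ n)
          (h₁ x * Complex.log (1 - (x : ℂ)) / (2 * Real.pi * I) + h₂ x) := by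
  obtain ⟨hr0, hr1⟩ := hr
  have hh : ∀ ζ ∈ ball (1 : ℂ) r, h₁ ζ = -(1 / (2 * Real.pi * I)) *
      ((ζ - 1) * segmentMean f₁ g₁ ζ ζ) := hh₁
  have hdiag := differentiableOn_segmentMean hr1 hf₁ hg₁ isOpen_ball differentiableOn_id
    (mapsTo_id (ball (1 : ℂ) r))
  refine ⟨DifferentiableOn.congr (by fun_prop) hh, r / 4, by linarith, by linarith, ?_⟩
  set R : ℝ := 1 + r / 2 with hRdef
  have hR1 : 1 < R := by linarith
  have hR0 : 0 < R := by linarith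
  set s : ℝ := (1 + r / 4) / R with hsdef
  have hs0 : 0 ≤ s := by positivity
  have hs1 : s < 1 := by rw [hsdef, div_lt_one hR0]; linarith
  set c : ℂ := 2 * Real.pi * I with hcdef
  have hc : c ≠ 0 := two_pi_I_ne_zero
  set V := ball (1 : ℂ) (r / 4)
  have hnormV : ∀ z ∈ V, ‖z‖ < 1 + r / 4 := by
    intro z hz
    rw [mem_ball, dist_eq] at hz
    have := norm_add_le (z - 1) 1
    rw [sub_add_cancel, norm_one] at this
    linarith
  have hdiv : ∀ z ∈ V, ∀ w ∈ Icc 1 R, z / (w : ℂ) ∈ ball (1 : ℂ) r :=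
    fun z hz w hw => div_mem_ball_one hr0 hz hw
  have hRmem : R ∈ Icc 1 R := ⟨hR1.le, le_rfl⟩
  have hne : ∀ w ∈ Icc 1 R, (w : ℂ) ≠ 0 := fun w hw => ofReal_ne_zero.2 (by linarith [hw.1])
  obtain ⟨C, hC⟩ := exists_norm_sub_integral_le hf₁ (A := fun n => -c * a n) (fun z hz => by
    have h := ((ha z hz).mul_left (-c)).congr_fun fun n => mul_assoc (-c) (a n) (z ^ n)
    rwa [neg_mul, mul_div_cancel₀ _ hc] at h) hR1 (by linarith)
  set e : ℕ → ℂ := fun n => -c * a n - ∫ w in (1 : ℝ)..R, f₁ w / (w : ℂ) ^ (n + 1) with hedef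
  have hbs : Summable fun n => ‖b n‖ * s ^ n := by
    convert (hb s (by rwa [norm_real, Real.norm_of_nonneg hs0])).summable.norm using 2 with n
    rw [norm_mul, norm_pow, norm_real, Real.norm_of_nonneg hs0]
  obtain ⟨hTsum, hT⟩ := summable_and_differentiableOn_tsum hR0 hC hbs (isOpen_ball : IsOpen V)
    fun z hz => by rw [hsdef, div_mul_cancel₀ _ hR0.ne']; exact (hnormV z hz).le
  have hwcont : ContinuousOn (fun q : ℂ × ℝ => (q.2 : ℂ)) (V ×ˢ Icc 1 R) := by
    exact (continuous_ofReal.comp continuous_snd).continuousOn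
  have hquot : ContinuousOn (fun q : ℂ × ℝ => q.1 / (q.2 : ℂ)) (V ×ˢ Icc 1 R) :=
    continuousOn_fst.div hwcont fun q hq => hne q.2 hq.2
  have hG : DifferentiableOn ℂ (fun ζ => ∫ w in (1 : ℝ)..R, f₁ w * g₂ (ζ / w) / w) V := by
    refine differentiableOn_intervalIntegral_param isOpen_ball hR1.le ?_ fun w hw => ?_
    · exact ((hf₁.continuous.comp_continuousOn hwcont).mul (hg₂.continuousOn.comp hquot
        fun q hq => hdiv q.1 hq.1 q.2 hq.2)).div hwcont fun q hq => hne q.2 hq.2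
    · exact ((hg₂.comp (differentiableOn_id.div_const (w : ℂ))
        fun z hz => hdiv z hz w hw).const_mul _).div_const _
  have hS : DifferentiableOn ℂ
      (fun ζ => ∫ w in (1 : ℝ)..R, segmentMean f₁ g₁ ζ (ζ / w) * (ζ / (w : ℂ) ^ 2)) V := by
    refine differentiableOn_intervalIntegral_param isOpen_ball hR1.le ?_ fun w hw => ?_
    · exact ((continuousOn_segmentMean hr1 hf₁.continuous hg₁.continuousOn).comp
        (f := fun q : ℂ × ℝ => (q.1, q.1 / (q.2 : ℂ))) (continuousOn_fst.prodMk hquot)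
        fun q hq => ⟨mem_univ _, hdiv q.1 hq.1 q.2 hq.2⟩).mul
        (continuousOn_fst.div (hwcont.pow 2) fun q hq => pow_ne_zero 2 (hne q.2 hq.2))
    · exact (differentiableOn_segmentMean hr1 hf₁ hg₁ isOpen_ball
        (differentiableOn_id.div_const (w : ℂ)) fun z hz => hdiv z hz w hw).mul
        (differentiableOn_id.div_const _)
  have hB : DifferentiableOn ℂ
      (fun ζ => (ζ / R - 1) * segmentMean f₁ g₁ ζ (ζ / R) * log (1 - ζ / R)) V := by
    have hdivR : DifferentiableOn ℂ (fun ζ : ℂ => ζ / R) V := differentiableOn_id.div_const _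
    refine ((hdivR.sub_const 1).mul (differentiableOn_segmentMean hr1 hf₁ hg₁ isOpen_ball hdivR
      fun z hz => hdiv z hz R hRmem)).mul ((hdivR.const_sub 1).clog fun z hz => ?_)
    rw [sub_eq_add_neg]
    refine mem_slitPlane_of_norm_lt_one ?_
    rw [norm_neg, norm_div, norm_real, Real.norm_of_nonneg hR0.le, div_lt_one hR0]
    linarith [hnormV z hz]
  refine ⟨fun ζ => -c⁻¹ * ((∑' n, e n * b n * ζ ^ n) +
    (∫ w in (1 : ℝ)..R, f₁ w * g₂ (ζ / w) / w) +
    c⁻¹ * (-((ζ / R - 1) * segmentMean f₁ g₁ ζ (ζ / R) * log (1 - ζ / R)) -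
      ∫ w in (1 : ℝ)..R, segmentMean f₁ g₁ ζ (ζ / w) * (ζ / (w : ℂ) ^ 2))),
    ((hT.add hG).add ((hB.neg.sub hS).const_mul _)).const_mul _, fun x hx hx1 => ?_⟩
  have hx0 : 0 < x := by linarith
  have hxV : (x : ℂ) ∈ V := by
    rw [mem_ball, dist_eq, ← ofReal_one, ← ofReal_sub, norm_real, Real.norm_eq_abs, abs_lt]
    constructor <;> linarith
  have hxr : (x : ℂ) ∈ ball (1 : ℂ) r := ball_subset_ball (by linarith) hxV
  have hgint : ∫ w in (1 : ℝ)..R, f₁ w * g (x / w) / w =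
      c⁻¹ * (∫ w in (1 : ℝ)..R, f₁ w * (g₁ (x / w) * log (1 - x / w)) / w) +
        ∫ w in (1 : ℝ)..R, f₁ w * g₂ (x / w) / w := by
    have hu : ContinuousOn (fun w : ℝ => (x / w : ℂ)) (Icc 1 R) :=
      continuousOn_const.div continuous_ofReal.continuousOn hne
    have hlt : ∀ w ∈ Icc 1 R, x / w < 1 := fun w hw => by
      rw [div_lt_one (by linarith [hw.1])]; linarith [hw.1]
    have hslit : ∀ w ∈ Icc 1 R, (1 - x / w : ℂ) ∈ slitPlane := fun w hw => by
      have h : (1 - x / w : ℂ) = ((1 - x / w : ℝ) : ℂ) := by push_cast; rfl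
      rw [h, ofReal_mem_slitPlane, sub_pos]
      exact hlt w hw
    have hf : ContinuousOn (fun w : ℝ => f₁ w) (Icc 1 R) :=
      (hf₁.continuous.comp continuous_ofReal).continuousOn
    have hI1 : ContinuousOn (fun w : ℝ => f₁ w * (g₁ (x / w) * log (1 - x / w)) / w)
        (Icc 1 R) :=
      (hf.mul ((hg₁.continuousOn.comp hu fun w hw => hdiv x hxV w hw).mul
        ((continuousOn_const.sub hu).clog hslit))).div continuous_ofReal.continuousOn hne
    have hI2 : ContinuousOn (fun w : ℝ => f₁ w * g₂ (x / w) / w) (Icc 1 R) :=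
      (hf.mul (hg₂.continuousOn.comp hu fun w hw => hdiv x hxV w hw)).div
        continuous_ofReal.continuousOn hne
    rw [← intervalIntegral.integral_const_mul, ← intervalIntegral.integral_add
      ((hI1.intervalIntegrable_of_Icc hR1.le).const_mul _)
      (hI2.intervalIntegrable_of_Icc hR1.le)]
    refine intervalIntegral.integral_congr fun w hw => ?_
    rw [uIcc_of_le hR1.le] at hw
    have hcast : (x / w : ℂ) = ((x / w : ℝ) : ℂ) := by push_cast; rfl
    have hpos : 0 < x / w := div_pos hx0 (by linarith [hw.1])
    have hU' : (x / w : ℂ) ∈ U := by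
      rw [hU, hcast]
      refine ⟨?_, ?_⟩
      · rw [mem_ball_zero_iff, norm_real, Real.norm_of_nonneg hpos.le]
        linarith [hlt w hw, hε.1]
      · rintro ⟨y, hy, hyx⟩
        linarith [ofReal_injective hyx, hy.1, hlt w hw]
    have hnot : (x / w : ℂ) ∉ Complex.ofReal '' Set.Ici 1 := by
      rw [hcast]
      rintro ⟨y, hy, hyx⟩
      linarith [ofReal_injective hyx, mem_Ici.1 hy, hlt w hw]
    simp only [hrep _ (hdiv x hxV w hw) hU' hnot]
    ring
  have hsum := ((hTsum x hxV).hasSum.add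
    (hasSum_mul_integral hf₁.continuous hb hR1.le hx0 hx1)).mul_left (-c⁻¹)
  have hval : h₁ x * log (1 - x) / c + -c⁻¹ * ((∑' n, e n * b n * (x : ℂ) ^ n) +
      (∫ w in (1 : ℝ)..R, f₁ w * g₂ (x / w) / w) +
      c⁻¹ * (-((x / R - 1) * segmentMean f₁ g₁ x (x / R) * log (1 - x / R)) -
        ∫ w in (1 : ℝ)..R, segmentMean f₁ g₁ x (x / w) * (x / (w : ℂ) ^ 2))) =
      -c⁻¹ * ((∑' n, e n * b n * (x : ℂ) ^ n) +
        ∫ w in (1 : ℝ)..R, f₁ w * g (x / w) / w) := by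
    rw [hgint, integral_mul_log_eq hr1 hf₁ hg₁ hx0 hx1 hR1.le fun w hw => hdiv x hxV w hw,
      hh x hxr]
    ring
  rw [hval]
  refine hsum.congr_fun fun n => ?_
  field_simp
  ring
end
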